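/- Let K be a valued field whose value group has a least positive element, regarded as an L_VR-structure, elementarily equivalent to ℂ((t)), with residue field k, and let L be an elementary L_VR-extension of K, with valuation ring O_L, residue field k_L ⊇ k and residue map res : O_L → k_L. If a, b ∈ O_L are such that res(a) and res(b) are both transcendental over k, then a and b realize the same complete type over K: for every L_VR-formula φ(x) with parameters from K, L ⊨ φ(a) if and only if L ⊨ φ(b). -/

import Mathlib

open FirstOrder

/-- The function symbols of the language `L_VR`: the ring language `{0, 1, +, ×}`. -/
inductive LVRFunc : ℕ → Type
  | zero : LVRFunc 0
  | one : LVRFunc 0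
  | add : LVRFunc 2
  | mul : LVRFunc 2

/-- The relation symbols of the language `L_VR`: a binary divisibility relation `|`,
a unary relation `N`, and a unary relation `P_n` for each `n ≥ 1`. -/
inductive LVRRel : ℕ → Type
  | dvd : LVRRel 2
  | N : LVRRel 1
  | pow : ℕ+ → LVRRel 1

/-- The first-order language `L_VR` of valuation rings. -/
def LVR : FirstOrder.Language where
  Functions := LVRFunc
  Relations := LVRRel

/-- Interpretation of the `L_VR` function symbols in a field. -/
def LVRfun (K : Type*) [Field K] : ∀ {n : ℕ}, LVRFunc n → (Fin n → K) → K
  | _, .zero => fun _ => 0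
  | _, .one => fun _ => 1
  | _, .add => fun x => x 0 + x 1
  | _, .mul => fun x => x 0 * x 1

/-- Interpretation of the `L_VR` relation symbols in a valued field (Mathlib's
multiplicative convention for valuations is order-reversing w.r.t. the additive
convention of the paper: `x | y` means `v_add(x) ≤ v_add(y)`, i.e. multiplicatively
`v (x 1) ≤ v (x 0)`; `N x` means `v_add(x) = 1_Γ`, where `γ₁` is the multiplicative
avatar of the least positive element of the value group; `P_n x` means `x` is an
`n`-th power). -/
def LVRrel {K : Type*} [Field K] {Γ₀ : Type*} [LinearOrderedCommGroupWithZero Γ₀]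
    (v : Valuation K Γ₀) (γ₁ : Γ₀) : ∀ {n : ℕ}, LVRRel n → (Fin n → K) → Prop
  | _, .dvd => fun x => v (x 1) ≤ v (x 0)
  | _, .N => fun x => v (x 0) = γ₁
  | _, .pow m => fun x => ∃ y : K, x 0 = y ^ (m : ℕ)

/-- A valued field, together with the (multiplicative avatar of the) least positive
element of its value group, as an `L_VR`-structure. -/
def valuedStructure {K : Type*} [Field K] {Γ₀ : Type*} [LinearOrderedCommGroupWithZero Γ₀]
    (v : Valuation K Γ₀) (γ₁ : Γ₀) : LVR.Structure K where
  funMap := LVRfun K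
  RelMap := LVRrel v γ₁

/-- `γ₁` is the multiplicative avatar of the least positive element of the value
group: the greatest element of `Γ₀ ∖ {0}` that is `< 1`. -/
def IsLeastPos {Γ₀ : Type*} [LinearOrderedCommGroupWithZero Γ₀] (γ₁ : Γ₀) : Prop :=
  γ₁ ≠ 0 ∧ γ₁ < 1 ∧ ∀ δ : Γ₀, δ ≠ 0 → δ < 1 → δ ≤ γ₁

/-- `ℂ((t))`, the field of formal Laurent series over `ℂ` with its `t`-adic
valuation, as an `L_VR`-structure. -/
noncomputable def laurentStructure : LVR.Structure (LaurentSeries ℂ) :=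
  valuedStructure (Valued.v : Valuation (LaurentSeries ℂ) (WithZero (Multiplicative ℤ)))
    ((Multiplicative.ofAdd (-1 : ℤ) : Multiplicative ℤ) : WithZero (Multiplicative ℤ))

open Polynomial

/-- First-order properties, in valuation-theoretic form, of valued fields elementarily equivalent
to `ℂ((t))`: `t` is a uniformizer, the residue field is algebraically closed of characteristic
zero, the value group is a `ℤ`-group, and the valuation is henselian. -/
structure TModel {M Γ : Type*} [Field M] [LinearOrderedCommGroupWithZero Γ]
    (v : Valuation M Γ) (t : M) : Prop where
  ne_zero : t ≠ 0
  lt_one : v t < 1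
  le_of_lt_one : ∀ x, v x < 1 → v x ≤ v t
  natCast : ∀ n : ℕ, n ≠ 0 → v (n : M) = 1
  div : ∀ n : ℕ, n ≠ 0 → ∀ x : M, x ≠ 0 → ∃ i < n, ∃ y : M, v x = v (t ^ i * y ^ n)
  res : ∀ d : ℕ, d ≠ 0 → ∀ a : Fin d → M, (∀ i, v (a i) ≤ 1) →
    ∃ m, v m ≤ 1 ∧ v (m ^ d + ∑ i, a i * m ^ (i : ℕ)) < 1
  hensel : ∀ p : M[X], p.Monic → Irreducible p → ∀ i ≤ p.natDegree,
    v (p.coeff i) ^ p.natDegree ≤ v (p.coeff 0) ^ (p.natDegree - i)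

namespace TModel

section Extension

variable {M Ω Γ : Type*} [Field M] [Field Ω] [Algebra M Ω] [LinearOrderedCommGroupWithZero Γ]
  {w : Valuation Ω Γ} {t : M}

local notation "ι" => algebraMap M Ω

theorem charZero {M Γ : Type*} [Field M] [LinearOrderedCommGroupWithZero Γ]
    {v : Valuation M Γ} {t : M} (h : TModel v t) : CharZero M := by
  refine charZero_of_inj_zero fun n hn => ?_
  by_contra hn'
  have := h.natCast n hn'
  rw [hn, map_zero] at this
  exact zero_ne_one this

theorem map_pow_natDegree (h : TModel (w.comap ι) t) (β : Ω) (hβ : IsIntegral M β) :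
    w β ^ (minpoly M β).natDegree = w (ι ((minpoly M β).coeff 0)) := by
  set p := minpoly M β with hp
  have hpm : p.Monic := minpoly.monic hβ
  have hirr : Irreducible p := minpoly.irreducible hβ
  have hd : 0 < p.natDegree := minpoly.natDegree_pos hβ
  have hH : ∀ i ≤ p.natDegree, w (ι (p.coeff i)) ^ p.natDegree ≤
    w (ι (p.coeff 0)) ^ (p.natDegree - i) := fun i hi => h.hensel p hpm hirr i hi
  have hsum : ∑ i ∈ Finset.range (p.natDegree + 1), ι (p.coeff i) * β ^ i = 0 := by
    have := minpoly.aeval M β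
    rw [aeval_eq_sum_range] at this
    simpa [Algebra.smul_def] using this
  set d := p.natDegree with hdd
  rcases lt_trichotomy (w β ^ d) (w (ι (p.coeff 0))) with hlt | heq | hlt
  · exfalso
    rw [Finset.sum_range_succ'] at hsum
    simp only [pow_zero, mul_one] at hsum
    have h0 : 0 < w (ι (p.coeff 0)) := lt_of_le_of_lt zero_le hlt
    have : w (∑ i ∈ Finset.range d, ι (p.coeff (i + 1)) * β ^ (i + 1)) < w (ι (p.coeff 0)) := by
      refine w.map_sum_lt h0.ne' fun i hi => ?_
      rw [Finset.mem_range] at hi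
      refine lt_of_pow_lt_pow_left₀ d zero_le ?_
      rw [map_mul, map_pow, mul_pow, ← pow_mul, mul_comm (i + 1) d, pow_mul]
      calc _ ≤ w (ι (p.coeff 0)) ^ (d - (i + 1)) * (w β ^ d) ^ (i + 1) := by
            exact mul_le_mul_left (hH _ hi) _
        _ < w (ι (p.coeff 0)) ^ (d - (i + 1)) * w (ι (p.coeff 0)) ^ (i + 1) := by
            have : 0 < w (ι (p.coeff 0)) ^ (d - (i + 1)) := pow_pos h0 _
            exact mul_lt_mul_of_pos_left (pow_lt_pow_left₀ hlt zero_le i.succ_ne_zero) this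
        _ = _ := by rw [← pow_add]; congr 1; omega
    have h2 := w.map_add_eq_of_lt_right this
    rw [hsum, map_zero] at h2
    exact h0.ne h2
  · exact heq
  · exfalso
    rw [Finset.sum_range_succ] at hsum
    have hc : p.coeff d = 1 := hpm
    rw [hc, map_one, one_mul] at hsum
    have h0 : 0 < w β ^ d := lt_of_le_of_lt zero_le hlt
    have : w (∑ i ∈ Finset.range d, ι (p.coeff i) * β ^ i) < w (β ^ d) := by
      rw [map_pow]
      refine w.map_sum_lt h0.ne' fun i hi => ?_
      rw [Finset.mem_range] at hi
      refine lt_of_pow_lt_pow_left₀ d zero_le ?_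
      rw [map_mul, map_pow, mul_pow, ← pow_mul, mul_comm i d, pow_mul]
      calc _ ≤ w (ι (p.coeff 0)) ^ (d - i) * (w β ^ d) ^ i := by
            exact mul_le_mul_left (hH _ hi.le) _
        _ < (w β ^ d) ^ (d - i) * (w β ^ d) ^ i := by
            have : 0 < (w β ^ d) ^ i := pow_pos h0 _
            exact mul_lt_mul_of_pos_right (pow_lt_pow_left₀ hlt zero_le (by omega)) this
        _ = _ := by rw [← pow_add]; congr 1; omega
    have h2 := w.map_add_eq_of_lt_right this
    rw [hsum, map_zero, map_pow] at h2
    exact h0.ne h2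

theorem map_eq_of_minpoly_eq (h : TModel (w.comap ι) t) {β β' : Ω} (hβ : IsIntegral M β)
    (hm : minpoly M β = minpoly M β') : w β = w β' := by
  have hβ' : IsIntegral M β' := by
    by_contra hc
    rw [minpoly.eq_zero hc] at hm
    exact minpoly.ne_zero hβ hm
  have h1 := h.map_pow_natDegree β hβ
  have h2 := h.map_pow_natDegree β' hβ'
  rw [← hm, ← h1] at h2
  exact (pow_left_inj₀ zero_le zero_le (minpoly.natDegree_pos hβ).ne').1 h2.symm

theorem map_sub_algebraMap_pow (h : TModel (w.comap ι) t) {β : Ω} (hβ : IsIntegral M β) (x : M) :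
    w (β - ι x) ^ (minpoly M β).natDegree = w (ι ((minpoly M β).eval x)) := by
  have h1 := h.map_pow_natDegree (β - ι x) (hβ.sub isIntegral_algebraMap)
  rwa [minpoly.sub_algebraMap, ← taylor_apply, natDegree_taylor, taylor_coeff_zero] at h1

theorem map_sub_eq_of_minpoly_eq (h : TModel (w.comap ι) t) {β β' : Ω} (hβ : IsIntegral M β)
    (hm : minpoly M β = minpoly M β') (x : M) : w (β - ι x) = w (β' - ι x) :=
  h.map_eq_of_minpoly_eq (hβ.sub isIntegral_algebraMap) (by
    rw [minpoly.sub_algebraMap, minpoly.sub_algebraMap, hm])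

theorem exists_residue (h : TModel (w.comap ι) t) {β : Ω} (hβ : IsIntegral M β) (hβ1 : w β ≤ 1) :
    ∃ m : M, w (ι m) ≤ 1 ∧ w (β - ι m) < 1 := by
  have hpm : (minpoly M β).Monic := minpoly.monic hβ
  have hd : 0 < (minpoly M β).natDegree := minpoly.natDegree_pos hβ
  have key := h.map_sub_algebraMap_pow hβ
  have h0 := h.map_pow_natDegree β hβ
  have hH := h.hensel _ hpm (minpoly.irreducible hβ)
  set p := minpoly M β
  obtain ⟨m, hm1, hm2⟩ := h.res p.natDegree hd.ne' (fun i => p.coeff i) fun i => by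
    have := hH i i.2.le
    rw [Valuation.comap_apply, Valuation.comap_apply, ← h0] at this
    by_contra! hc
    exact absurd (this.trans (pow_le_one' (pow_le_one' hβ1 _) _))
      (one_lt_pow₀ hc hd.ne').not_ge
  refine ⟨m, hm1, ?_⟩
  have he : p.eval m = m ^ p.natDegree + ∑ i : Fin p.natDegree, p.coeff i * m ^ (i : ℕ) := by
    rw [eval_eq_sum_range, Finset.sum_range_succ, add_comm, hpm.coeff_natDegree, one_mul,
      Finset.sum_range]
  rw [← he, Valuation.comap_apply, ← key] at hm2
  by_contra! hc
  exact absurd hm2 (one_le_pow₀ hc).not_gt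

theorem mem_range_of_forall_root (h : TModel (w.comap ι) t) [IsAlgClosed Ω] {β : Ω}
    (hβ : IsIntegral M β)
    (H : ∀ β', IsIntegral M β' → minpoly M β = minpoly M β' → β' = β) :
    β ∈ (algebraMap M Ω).range := by
  have := h.charZero
  rw [← minpoly.natDegree_eq_one_iff]
  refine le_antisymm ?_ (minpoly.natDegree_pos hβ)
  have hs : ((minpoly M β).map ι).Splits := IsAlgClosed.splits _
  have hsep : (minpoly M β).Separable := (minpoly.irreducible hβ).separable
  have hnd : ((minpoly M β).map ι).roots.Nodup := nodup_roots hsep.map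
  rw [← natDegree_map ι, ← splits_iff_card_roots.1 hs]
  have hall : ∀ x ∈ ((minpoly M β).map ι).roots, x = β := fun x hx => by
    have hx' : aeval x (minpoly M β) = 0 := by
      rw [mem_roots', IsRoot, eval_map_algebraMap] at hx
      exact hx.2
    have hm : minpoly M β = minpoly M x :=
      minpoly.eq_of_irreducible_of_monic (minpoly.irreducible hβ) hx' (minpoly.monic hβ)
    refine H x ⟨minpoly M β, minpoly.monic hβ, hx'⟩ hm
  rw [Multiset.eq_replicate_card.2 hall] at hnd
  by_contra! hc
  exact Multiset.nodup_iff_le.1 hnd β ((Multiset.replicate_le_replicate β).2 hc)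

theorem exists_eval_add_eq (w : Valuation Ω Γ) (f : Polynomial Ω) (hf : ∀ i, w (f.coeff i) ≤ 1) (x y : Ω)
    (hx : w x ≤ 1) (hy : w y ≤ 1) :
    ∃ k, w k ≤ 1 ∧ f.eval (x + y) = f.eval x + f.derivative.eval x * y + k * y ^ 2 := by
  have hc : (f.coeffs : Set Ω) ⊆ w.integer := fun c hc => by
    obtain ⟨n, -, rfl⟩ := mem_coeffs_iff.1 hc
    exact hf n
  obtain ⟨k, hk⟩ := (f.toSubring w.integer hc).binomExpansion ⟨x, hx⟩ ⟨y, hy⟩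
  refine ⟨k, k.2, ?_⟩
  have hmap : (f.toSubring w.integer hc).map w.integer.subtype = f := map_toSubring _ _ _
  have := congrArg w.integer.subtype hk
  simp only [map_add, map_mul, map_pow, ← eval_map_apply, ← derivative_map, hmap] at this
  exact this

theorem mem_range_of_simple_root (h : TModel (w.comap ι) t) [IsAlgClosed Ω] (f : M[X])
    (hf : ∀ i, w (ι (f.coeff i)) ≤ 1) {β : Ω} (hβ : IsIntegral M β) (hroot : aeval β f = 0)
    (hβ1 : w β ≤ 1) (hder : w (aeval β (derivative f)) = 1) : β ∈ (algebraMap M Ω).range := by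
  refine h.mem_range_of_forall_root hβ fun β' hβ' hm => ?_
  by_contra hne
  obtain ⟨m, hm1, hm2⟩ := h.exists_residue hβ hβ1
  have hm3 : w (β' - ι m) < 1 := by rwa [← h.map_sub_eq_of_minpoly_eq hβ hm m]
  have hlt : w (β' - β) < 1 := by
    have := w.map_sub_lt hm3 hm2
    rwa [sub_sub_sub_cancel_right] at this
  have hroot' : aeval β' f = 0 := by
    obtain ⟨q, rfl⟩ := minpoly.dvd M β hroot
    rw [map_mul, hm, minpoly.aeval, zero_mul]
  obtain ⟨k, hk1, hk2⟩ := exists_eval_add_eq w (f.map ι) (by simpa using hf) β (β' - β) hβ1 hlt.le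
  rw [add_sub_cancel, derivative_map, eval_map_algebraMap, eval_map_algebraMap,
    eval_map_algebraMap, hroot, hroot', zero_add, pow_two, ← mul_assoc, ← add_mul, eq_comm,
    mul_eq_zero, or_iff_left (sub_ne_zero.2 hne)] at hk2
  have h3 : w (k * (β' - β)) < w (aeval β (derivative f)) := by
    rw [hder, map_mul]
    exact (mul_le_of_le_one_left' hk1).trans_lt hlt
  have := w.map_add_eq_of_lt_left h3
  rw [hk2, map_zero, hder] at this
  exact zero_ne_one this

theorem exists_pow_eq_of_unit (h : TModel (w.comap ι) t) [IsAlgClosed Ω] {n : ℕ} (hn : n ≠ 0)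
    {u : M} (hu : w (ι u) = 1) {β : Ω} (hβ : β ^ n = ι u) : β ∈ (algebraMap M Ω).range := by
  have hβ1 : w β = 1 := by
    have := congrArg w hβ
    rw [map_pow, hu] at this
    exact (pow_eq_one_iff_of_nonneg zero_le hn).1 this
  have hroot : aeval β (X ^ n - C u : M[X]) = 0 := by simp [hβ]
  refine h.mem_range_of_simple_root (X ^ n - C u) (fun i => ?_)
    ⟨X ^ n - C u, monic_X_pow_sub_C u hn, hroot⟩ hroot hβ1.le ?_
  · rw [coeff_sub, coeff_X_pow, coeff_C, map_sub]
    refine (w.map_sub _ _).trans (max_le ?_ ?_) <;> split_ifs <;> simp [hu]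
  · have := h.natCast n hn
    rw [Valuation.comap_apply, map_natCast] at this
    simp [derivative_X_pow, hβ1, this]

end Extension

theorem congr {M Γ Γ' : Type*} [Field M] [LinearOrderedCommGroupWithZero Γ]
    [LinearOrderedCommGroupWithZero Γ'] {v : Valuation M Γ} {v' : Valuation M Γ'} {t : M}
    (h : TModel v t) (hv : v.IsEquiv v') : TModel v' t where
  ne_zero := h.ne_zero
  lt_one := hv.lt_one_iff_lt_one.1 h.lt_one
  le_of_lt_one x hx := (hv x t).1 (h.le_of_lt_one x (hv.lt_one_iff_lt_one.2 hx))
  natCast n hn := hv.eq_one_iff_eq_one.1 (h.natCast n hn)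
  div n hn x hx := by
    obtain ⟨i, hi, y, hy⟩ := h.div n hn x hx
    exact ⟨i, hi, y, hv.eq_iff.1 hy⟩
  res d hd a ha := by
    obtain ⟨m, h1, h2⟩ := h.res d hd a fun i => hv.le_one_iff_le_one.2 (ha i)
    exact ⟨m, hv.le_one_iff_le_one.1 h1, hv.lt_one_iff_lt_one.1 h2⟩
  hensel p hp hirr i hi := by
    have := h.hensel p hp hirr i hi
    rw [← map_pow, ← map_pow] at this ⊢
    exact (hv _ _).1 this

end TModel

theorem Valuation.exists_extension {M Ω Γ : Type*} [Field M] [Field Ω]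
    [LinearOrderedCommGroupWithZero Γ] (f : M →+* Ω) (v : Valuation M Γ) :
    ∃ W : ValuationSubring Ω, v.IsEquiv (W.valuation.comap f) := by
  obtain ⟨W, hW, hloc⟩ := IsLocalRing.exists_factor_valuationRing
    (f.comp v.valuationSubring.subtype)
  refine ⟨W, ?_⟩
  rw [Valuation.isEquiv_iff_val_le_one]
  intro x
  have h1 : ∀ y : M, v y ≤ 1 → f y ∈ W := fun y hy => hW ⟨y, hy⟩
  rw [Valuation.comap_apply, ValuationSubring.valuation_le_one_iff]
  refine ⟨h1 x, fun hx => ?_⟩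
  by_contra! hc
  have hx0 : x ≠ 0 := by rintro rfl; simp at hc
  have hinv : v x⁻¹ ≤ 1 := by
    rw [map_inv₀]; exact inv_le_one_of_one_le₀ hc.le
  have hu : IsUnit ((f.comp v.valuationSubring.subtype).codRestrict W.toSubring hW ⟨x⁻¹, hinv⟩) := by
    refine IsUnit.of_mul_eq_one ⟨f x, hx⟩ ?_
    ext
    change f x⁻¹ * f x = 1
    rw [← map_mul, inv_mul_cancel₀ hx0, map_one]
  have := hloc.map_nonunit _ hu
  obtain ⟨y, hy⟩ := this.exists_right_inv
  have hy' : x⁻¹ * (y : M) = 1 := congrArg Subtype.val hy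
  have : (y : M) = x := by field_simp at hy'; exact hy'
  exact absurd y.2 (by
    rw [Valuation.mem_valuationSubring_iff, this]; exact hc.not_ge)

namespace TModel

section Model

variable {M Γ : Type*} [Field M] [LinearOrderedCommGroupWithZero Γ] {v : Valuation M Γ} {t : M}

theorem isPow_iff (h : TModel v t) {n : ℕ} (hn : n ≠ 0) (x : M) :
    (∃ y, x = y ^ n) ↔ ∃ y, v x = v (y ^ n) := by
  refine ⟨fun ⟨y, hy⟩ => ⟨y, by rw [hy]⟩, fun ⟨y, hy⟩ => ?_⟩
  rcases eq_or_ne y 0 with rfl | hy0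
  · rw [zero_pow hn, map_zero, map_eq_zero] at hy
    exact ⟨0, by rw [hy, zero_pow hn]⟩
  obtain ⟨W, hW⟩ := v.exists_extension (algebraMap M (AlgebraicClosure M))
  have hu : W.valuation (algebraMap M (AlgebraicClosure M) (x / y ^ n)) = 1 := by
    refine hW.eq_one_iff_eq_one.1 ?_
    rw [map_div₀, hy, div_self]
    simpa [hn] using hy0
  obtain ⟨β, hβ⟩ := IsAlgClosed.exists_pow_nat_eq
    (algebraMap M (AlgebraicClosure M) (x / y ^ n)) (Nat.pos_of_ne_zero hn)
  obtain ⟨m, rfl⟩ := (h.congr hW).exists_pow_eq_of_unit hn hu hβ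
  rw [← map_pow] at hβ
  have := (algebraMap M (AlgebraicClosure M)).injective hβ
  refine ⟨m * y, ?_⟩
  rw [mul_pow, this, div_mul_cancel₀]
  exact pow_ne_zero _ hy0

theorem map_eval_of_irreducible (h : TModel v t) (p : M[X]) (hp : p.Monic) (hirr : Irreducible p) :
    ∀ x, v (p.eval x) = max (v (x - -(p.nextCoeff / p.natDegree)) ^ p.natDegree)
      (v (p.eval (-(p.nextCoeff / p.natDegree)))) := by
  have hd : 0 < p.natDegree := hirr.natDegree_pos
  have := h.charZero
  obtain ⟨W, hW⟩ := v.exists_extension (algebraMap M (AlgebraicClosure M))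
  have h' := h.congr hW
  set e := -(p.nextCoeff / p.natDegree) with he
  have h1 : ∀ x, v (x - e) ^ p.natDegree ≤ v (p.eval x) := fun x => by
    have := h.hensel (taylor x p) (by rw [Monic, leadingCoeff_taylor]; exact hp)
      ((MulEquiv.irreducible_iff (taylorEquiv x)).2 hirr) (p.natDegree - 1)
      (by rw [natDegree_taylor]; omega)
    have hle : (hasseDeriv (p.natDegree - 1) p).natDegree ≤ 1 :=
      (natDegree_hasseDeriv_le _ _).trans (by omega)
    have hc : (taylor x p).coeff (p.natDegree - 1) = p.natDegree * (x - e) := by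
      rw [taylor_coeff, eq_X_add_C_of_natDegree_le_one hle, hasseDeriv_coeff, hasseDeriv_coeff,
        zero_add, Nat.choose_self, add_comm 1, Nat.sub_add_cancel hd, hp.coeff_natDegree]
      have h2 : p.natDegree.choose (p.natDegree - 1) = p.natDegree := by
        rw [Nat.choose_symm hd, Nat.choose_one_right]
      rw [h2, he, nextCoeff_of_natDegree_pos hd]
      have : (p.natDegree : M) ≠ 0 := by exact_mod_cast hd.ne'
      simp
      field_simp
    rw [natDegree_taylor, hc, taylor_coeff_zero, map_mul, h.natCast _ hd.ne', one_mul,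
      Nat.sub_sub_self hd, pow_one] at this
    exact this
  obtain ⟨β, hβ⟩ := IsAlgClosed.exists_aeval_eq_zero (AlgebraicClosure M) p
    (by rw [degree_eq_natDegree hp.ne_zero]; exact_mod_cast hd.ne')
  have hm : p = minpoly M β := minpoly.eq_of_irreducible_of_monic hirr hβ hp
  have hβi : IsIntegral M β := ⟨p, hp, hβ⟩
  have key := h'.map_sub_algebraMap_pow hβi
  rw [← hm] at key
  have htri : ∀ x y, v (p.eval y) ≤ max (v (x - y) ^ p.natDegree) (v (p.eval x)) := fun x y => by
    rw [le_max_iff, ← map_pow, hW _ _, hW _ _]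
    simp only [Valuation.comap_apply, map_pow, ← key, map_sub]
    rw [pow_le_pow_iff_left₀ zero_le zero_le hd.ne', pow_le_pow_iff_left₀ zero_le zero_le hd.ne',
      ← le_max_iff]
    refine le_trans (le_of_eq ?_) (W.valuation.map_add _ _)
    congr 1
    ring
  intro x
  refine le_antisymm ?_ (max_le (h1 x) ?_)
  · rw [Valuation.map_sub_swap]
    exact htri e x
  · exact (htri x e).trans (max_le (h1 x) le_rfl)

end Model

end TModel

open scoped Pointwise

theorem Valuation.exists_normalized {D Γ : Type*} [Field D]
    [LinearOrderedCommGroupWithZero Γ] (w : Valuation D Γ) {p : D[X]} (hp : p ≠ 0) :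
    ∃ c : D, c ≠ 0 ∧ (∀ n, w ((C c⁻¹ * p).coeff n) ≤ 1) ∧ ∃ n, (C c⁻¹ * p).coeff n = 1 := by
  obtain ⟨n, hn, hmax⟩ := p.support.exists_max_image (fun n => w (p.coeff n))
    (support_nonempty.2 hp)
  have hc : p.coeff n ≠ 0 := mem_support_iff.1 hn
  have hw : w (p.coeff n) ≠ 0 := by simpa using hc
  refine ⟨p.coeff n, hc, fun k => ?_, n, by rw [coeff_C_mul, inv_mul_cancel₀ hc]⟩
  rw [coeff_C_mul, map_mul, map_inv₀]
  by_cases hk : k ∈ p.support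
  · calc _ ≤ (w (p.coeff n))⁻¹ * w (p.coeff n) := mul_le_mul_right (hmax k hk) _
      _ = 1 := inv_mul_cancel₀ hw
  · simp [notMem_support_iff.1 hk]

namespace ValuationSubring

theorem eval_divX_mem {N : Type*} [Field N] {U : ValuationSubring N} {p : N[X]}
    (hp : ∀ i, p.coeff i ∈ U) {x : N} (hx : p.eval x = 0) (j : ℕ) :
    (divX^[j] p).eval x ∈ U ∧ x * (divX^[j] p).eval x ∈ U := by
  have hc : ∀ j n, (divX^[j] p).coeff n = p.coeff (n + j) := fun j => by
    induction j with
    | zero => simp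
    | succ j ih => intro n; rw [Function.iterate_succ_apply', coeff_divX, ih]; congr 1; ring
  have hstep : ∀ j, x * (divX^[j + 1] p).eval x = (divX^[j] p).eval x - p.coeff j := fun j => by
    have h1 := congrArg (eval x) (divX_mul_X_add (divX^[j] p))
    rw [eval_add, eval_mul, eval_X, eval_C, hc, zero_add, ← Function.iterate_succ_apply' divX]
      at h1
    rw [← h1, add_sub_cancel_right, mul_comm]
  have key : ∀ j, (divX^[j] p).eval x ∈ U := fun j => by
    by_cases hxU : x ∈ U
    · rw [eval_eq_sum_range]
      exact sum_mem fun i _ => U.mul_mem _ _ (by rw [hc]; exact hp _) (pow_mem hxU i)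
    · have hxi : x⁻¹ ∈ U := (U.mem_or_inv_mem x).resolve_left hxU
      have hx0 : x ≠ 0 := by rintro rfl; exact hxU U.zero_mem
      induction j with
      | zero => simp [hx, U.zero_mem]
      | succ j ih =>
        have h2 : (divX^[j + 1] p).eval x = x⁻¹ * ((divX^[j] p).eval x - p.coeff j) := by
          rw [← hstep, inv_mul_cancel_left₀ hx0]
        rw [h2]
        exact U.mul_mem _ _ hxi (sub_mem ih (hp j))
  refine ⟨key j, ?_⟩
  cases j with
  | zero => simp [hx, U.zero_mem]
  | succ j => rw [hstep]; exact sub_mem (key j) (hp j)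

theorem exists_eval_divX_valuation_eq_one {N : Type*} [Field N] {U : ValuationSubring N} {p : N[X]}
    (hp : ∀ i, p.coeff i ∈ U) {k : ℕ} (hk : p.coeff k = 1) {x : N} (hxU : x ∈ U)
    (hx : p.eval x = 0) : ∃ j, U.valuation ((divX^[j] p).eval x) = 1 := by
  have hc : ∀ j n, (divX^[j] p).coeff n = p.coeff (n + j) := fun j => by
    induction j with
    | zero => simp
    | succ j ih => intro n; rw [Function.iterate_succ_apply', coeff_divX, ih]; congr 1; ring
  have h1 := congrArg (eval x) (divX_mul_X_add (divX^[k] p))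
  rw [eval_add, eval_mul, eval_X, eval_C, hc, zero_add, ← Function.iterate_succ_apply' divX,
    hk] at h1
  by_contra! hne
  have hlt : ∀ j, U.valuation ((divX^[j] p).eval x) < 1 := fun j =>
    lt_of_le_of_ne ((U.valuation_le_one_iff _).2 (eval_divX_mem hp hx j).1) (hne j)
  have h2 : U.valuation ((divX^[k + 1] p).eval x * x) < 1 := by
    rw [map_mul]
    exact (mul_le_of_le_one_right' ((U.valuation_le_one_iff _).2 hxU)).trans_lt (hlt _)
  have h3 := U.valuation.map_sub_lt (hlt k) h2
  rw [← h1, add_sub_cancel_left, map_one] at h3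
  exact lt_irrefl _ h3

variable {D N : Type*} [Field D] [Field N] [Algebra D N]

/-- An element of a valuation ring `V` of an algebraic extension of `D` is a quotient of elements
integral over `V ∩ D` with denominator a unit of `V`. -/
theorem exists_integral_denominator [Algebra.IsAlgebraic D N] (A : ValuationSubring D)
    (V : ValuationSubring N) (hV : V.comap (algebraMap D N) = A) {x : N} (hx : x ∈ V) :
    ∃ y, V.valuation y = 1 ∧ IsIntegral A y ∧ IsIntegral A (x * y) := by
  obtain ⟨p, hp0, hp⟩ := Algebra.IsAlgebraic.isAlgebraic (R := D) x
  obtain ⟨c, hc, hle, k, hk⟩ := A.valuation.exists_normalized hp0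
  set q := (C c⁻¹ * p).map (algebraMap D N) with hq
  have hqx : q.eval x = 0 := by rw [hq, eval_map_algebraMap, map_mul, hp, mul_zero]
  have hqA : ∀ i, ∃ a : A, q.coeff i = algebraMap D N a := fun i =>
    ⟨⟨_, (A.valuation_le_one_iff _).1 (hle i)⟩, by rw [hq, coeff_map]⟩
  have hqU : ∀ U : ValuationSubring N, (∀ a : A, algebraMap D N a ∈ U) → ∀ i, q.coeff i ∈ U :=
    fun U hU i => by obtain ⟨a, ha⟩ := hqA i; rw [ha]; exact hU a
  have hAV : ∀ a : A, algebraMap D N a ∈ V := fun a => by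
    have h : (a : D) ∈ V.comap (algebraMap D N) := by rw [hV]; exact a.2
    exact h
  have h_integral : ∀ z : N, (∀ U : ValuationSubring N, (∀ a : A, algebraMap D N a ∈ U) → z ∈ U) →
      IsIntegral A z := fun z hz => by
    have h1 : z ∈ (⨅ U : {U : ValuationSubring N // Set.range (algebraMap A N) ⊆ U.toSubring},
        U.1.toSubring) := by
      rw [Subring.mem_iInf]
      rintro ⟨U, hU⟩
      exact hz U fun a => hU ⟨a, rfl⟩
    rw [iInf_valuationSubring_superset] at h1
    have h2 : IsIntegral (Subring.closure (Set.range (algebraMap A N))) z := h1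
    have h3 : Subring.closure (Set.range (algebraMap A N)) = (algebraMap A N).range := by
      rw [← RingHom.coe_range, Subring.closure_eq]
    rw [h3] at h2
    obtain ⟨f, hf, hfz⟩ := h2
    obtain ⟨g, hg1, -, hg2⟩ := lifts_and_natDegree_eq_and_monic (f := (algebraMap A N).rangeRestrict)
      (p := f) (by
        rw [lifts_iff_coeff_lifts]; intro n; exact (algebraMap A N).rangeRestrict_surjective _) hf
    refine ⟨g, hg2, ?_⟩
    rw [← hg1, eval₂_map] at hfz
    exact hfz
  obtain ⟨j, hj⟩ := exists_eval_divX_valuation_eq_one (hqU V hAV) (k := k)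
    (by rw [hq, coeff_map, hk, map_one]) hx hqx
  exact ⟨_, hj, h_integral _ fun U hU => (eval_divX_mem (hqU U hU) hqx j).1,
    h_integral _ fun U hU => (eval_divX_mem (hqU U hU) hqx j).2⟩

theorem exists_algEquiv_of_comap_eq [IsGalois D N] (V₁ V₂ : ValuationSubring N)
    (hV : V₁.comap (algebraMap D N) = V₂.comap (algebraMap D N)) :
    ∃ τ : N ≃ₐ[D] N, ∀ x, x ∈ V₁ ↔ τ x ∈ V₂ := by
  set A := V₁.comap (algebraMap D N) with hA
  let B := integralClosure A N
  have hBV : ∀ V : ValuationSubring N, V.comap (algebraMap D N) = A → ∀ b : B, (b : N) ∈ V := by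
    intro V hV b
    have h1 : IsIntegral V (b : N) := by
      obtain ⟨f, hf, hfb⟩ := b.2
      let i : A →+* V := ((algebraMap D N).comp A.subtype).codRestrict V fun a => by
        have h : (a : D) ∈ V.comap (algebraMap D N) := by rw [hV]; exact a.2
        exact h
      refine ⟨f.map i, hf.map i, ?_⟩
      rw [eval₂_map]
      exact hfb
    obtain ⟨y, hy⟩ := IsIntegrallyClosed.isIntegral_iff.1 h1
    rw [← hy]
    exact y.2
  let _ : MulSemiringAction Gal(N/D) B :=
    { smul := fun g b => ⟨g b, by
        have := IsIntegral.map (g.toAlgHom.restrictScalars A) b.2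
        exact this⟩
      one_smul := fun b => rfl
      mul_smul := fun g g' b => rfl
      smul_zero := fun g => Subtype.ext (map_zero g)
      smul_add := fun g b b' => Subtype.ext (map_add g _ _)
      smul_one := fun g => Subtype.ext (map_one g)
      smul_mul := fun g b b' => Subtype.ext (map_mul g _ _) }
  have hsmul : ∀ (g : Gal(N/D)) (b : B), ((g • b : B) : N) = g b := fun g b => rfl
  have : SMulCommClass Gal(N/D) A B := ⟨fun g a b => Subtype.ext <| by
    rw [hsmul, Subalgebra.coe_smul, Subalgebra.coe_smul, hsmul]
    exact map_smul (g.toAlgHom.restrictScalars A) a (b : N)⟩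
  let _ : TopologicalSpace B := ⊥
  have : DiscreteTopology B := ⟨rfl⟩
  have : ContinuousSMul Gal(N/D) B := continuousSMul_iff_stabilizer_isOpen.2 fun b => by
    have h1 := stabilizer_isOpen_of_isIntegral (K := D) (b : N)
    convert h1 using 1
    ext g
    simp only [SetLike.mem_coe, MulAction.mem_stabilizer_iff]
    rw [Subtype.ext_iff]
    rfl
  have : Algebra.IsInvariant A B Gal(N/D) := ⟨fun b hb => by
    obtain ⟨d, hd⟩ := (InfiniteGalois.mem_range_algebraMap_iff_fixed (b : N)).2
      fun g : Gal(N/D) => congrArg Subtype.val (hb g)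
    refine ⟨⟨d, ?_⟩, Subtype.ext hd⟩
    have := hBV V₁ rfl b
    rw [← hd] at this
    exact this⟩
  let m : (V : ValuationSubring N) → V.comap (algebraMap D N) = A → Ideal B := fun V hV =>
    (IsLocalRing.maximalIdeal V).comap (B.val.toRingHom.codRestrict V.toSubring (hBV V hV))
  have hm : ∀ V hV (b : B), b ∈ m V hV ↔ V.valuation (b : N) < 1 := fun V hV b => by
    rw [← V.valuation_lt_one_iff ⟨b, hBV V hV b⟩]
    rfl
  have hprime : ∀ V hV, (m V hV).IsPrime := fun V hV => Ideal.comap_isPrime _ _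
  have hmA : ∀ V hV (a : A), algebraMap A B a ∈ m V hV ↔ A.valuation (a : D) < 1 := by
    intro V hV a
    have hE : (V.valuation.comap (algebraMap D N)).IsEquiv A.valuation := by
      rw [Valuation.isEquiv_iff_val_le_one]
      intro x
      rw [Valuation.comap_apply, valuation_le_one_iff, valuation_le_one_iff, ← hV, mem_comap]
    rw [hm V hV, ← hE.lt_one_iff_lt_one]
    rfl
  have := hprime V₁ rfl
  have := hprime V₂ hV.symm
  obtain ⟨g, hg⟩ := Algebra.IsInvariant.exists_smul_of_under_eq_of_profinite (A := A)
    (G := Gal(N/D)) (m V₁ rfl) (m V₂ hV.symm) (by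
      ext a
      exact (hmA V₁ rfl a).trans (hmA V₂ hV.symm a).symm)
  have hg' : ∀ b : B, b ∈ m V₁ rfl ↔ g • b ∈ m V₂ hV.symm := fun b => by
    rw [hg, Ideal.smul_mem_pointwise_smul_iff]
  have hone : ∀ V hV (b : B), V.valuation (b : N) = 1 ↔ b ∉ m V hV := fun V hV b => by
    rw [hm V hV, not_lt]
    exact ⟨fun h => h.ge, fun h => le_antisymm ((V.valuation_le_one_iff _).2 (hBV V hV b)) h⟩
  have key : ∀ V V' hV hV' (g : Gal(N/D)), (∀ b : B, b ∈ m V hV ↔ g • b ∈ m V' hV') →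
      ∀ x ∈ V, g x ∈ V' := fun V V' hV hV' g hg x hx => by
    obtain ⟨y, hy, hyi, hxy⟩ := exists_integral_denominator A V hV hx
    have h1 := (hone V hV ⟨y, hyi⟩).1 hy
    rw [hg, ← hone V' hV', hsmul] at h1
    have h2 := hBV V' hV' (g • ⟨_, hxy⟩)
    rw [hsmul] at h2
    rw [← valuation_le_one_iff] at h2 ⊢
    simp only [map_mul] at h1 h2
    rwa [h1, mul_one] at h2
  refine ⟨g, fun x => ⟨key V₁ V₂ rfl hV.symm g hg' x, fun hx => ?_⟩⟩
  have := key V₂ V₁ hV.symm rfl g⁻¹ (fun b => by rw [hg', smul_inv_smul]) _ hx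
  rwa [← AlgEquiv.mul_apply, inv_mul_cancel, AlgEquiv.one_apply] at this

end ValuationSubring

namespace Valuation

theorem map_eval_le_one {N Γ : Type*} [Field N] [LinearOrderedCommGroupWithZero Γ]
    (V : Valuation N Γ) {f : N[X]} (hf : ∀ n, V (f.coeff n) ≤ 1) {u : N} (hu : V u ≤ 1) :
    V (f.eval u) ≤ 1 := by
  rw [eval_eq_sum_range]
  refine V.map_sum_le fun i _ => ?_
  rw [map_mul, map_pow]
  exact mul_le_one' (hf i) (pow_le_one' hu i)

theorem exists_ne_of_sum_eq_zero {N Γ κ : Type*} [Field N] [LinearOrderedCommGroupWithZero Γ]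
    (V : Valuation N Γ) {s : Finset κ} {f : κ → N} (hs : ∑ i ∈ s, f i = 0) {k : κ} (hk : k ∈ s)
    (hfk : f k ≠ 0) : ∃ i ∈ s, ∃ j ∈ s, i ≠ j ∧ f i ≠ 0 ∧ V (f i) = V (f j) := by
  classical
  obtain ⟨j, hj, hmax⟩ := s.exists_max_image (fun i => V (f i)) ⟨k, hk⟩
  have hj0 : V (f j) ≠ 0 := by
    have h1 : V (f k) ≠ 0 := by simpa using hfk
    exact (lt_of_lt_of_le (zero_lt_iff.2 h1) (hmax k hk)).ne'
  by_contra! hc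
  have := V.map_sum_eq_of_lt hj fun i hi => by
    rw [Finset.mem_sdiff, Finset.mem_singleton] at hi
    refine lt_of_le_of_ne (hmax i hi.1) fun h => ?_
    refine hc i hi.1 j hj hi.2 (fun h0 => hj0 ?_) h
    rw [← h, h0, map_zero]
  rw [hs, map_zero] at this
  exact hj0 this.symm

theorem map_average_sub_le {N Γ : Type*} [Field N] [LinearOrderedCommGroupWithZero Γ]
    (V : Valuation N Γ) {s : Finset N} (hs : V (s.card : N) = 1) {e : N} {γ : Γ}
    (h : ∀ β ∈ s, V (β - e) ≤ γ) : V ((∑ β ∈ s, β) / s.card - e) ≤ γ := by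
  have h0 : (s.card : N) ≠ 0 := by intro h; rw [h, map_zero] at hs; exact zero_ne_one hs
  have : (∑ β ∈ s, β) / s.card - e = (∑ β ∈ s, (β - e)) / s.card := by
    rw [Finset.sum_sub_distrib, Finset.sum_const, nsmul_eq_mul]
    field_simp
  rw [this, map_div₀, hs, div_one]
  exact V.map_sum_le h

theorem exists_simple_root_near {D N Γ : Type*} [Field D] [Field N] [Algebra D N]
    [Algebra.IsAlgebraic D N] [IsAlgClosed N] [LinearOrderedCommGroupWithZero Γ]
    (V : Valuation N Γ) (hnat : ∀ n : ℕ, n ≠ 0 → V (n : N) = 1) {u : N} (hu : V u ≤ 1) :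
    ∃ (g : D[X]) (β : N), (∀ n, V (algebraMap D N (g.coeff n)) ≤ 1) ∧ aeval β g = 0 ∧ V β ≤ 1 ∧
      V (aeval β (derivative g)) = 1 ∧ V (u - β) < 1 := by
  let ι := algebraMap D N
  let P : D[X] → Prop := fun g => (∀ n, V (ι (g.coeff n)) ≤ 1) ∧ (∃ n, V (ι (g.coeff n)) = 1) ∧
    V (aeval u g) < 1
  obtain ⟨g, ⟨hg1, ⟨k, hk⟩, hg3⟩, hmin⟩ : ∃ g, MinimalFor P natDegree g := by
    refine exists_minimalFor_of_wellFoundedLT P natDegree ?_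
    obtain ⟨p, hp0, hp⟩ := Algebra.IsAlgebraic.isAlgebraic (R := D) u
    obtain ⟨c, hc, hle, k, hk⟩ := (V.comap ι).exists_normalized hp0
    refine ⟨C c⁻¹ * p, hle, ⟨k, by rw [hk, map_one, map_one]⟩, ?_⟩
    rw [map_mul, hp, mul_zero, map_zero]
    exact zero_lt_one
  have hmin' : ∀ f, P f → ¬ f.natDegree < g.natDegree := fun f hf hlt =>
    absurd (hmin hf hlt.le) hlt.not_ge
  have heval : ∀ f : D[X], (∀ n, V (ι (f.coeff n)) ≤ 1) → V (aeval u f) ≤ 1 := fun f hf => by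
    rw [← eval_map_algebraMap]
    exact V.map_eval_le_one (by simpa using hf) hu
  have hpos : 0 < g.natDegree := by
    by_contra! h0
    rw [eq_C_of_natDegree_le_zero h0] at hg3 hk
    rw [aeval_C] at hg3
    rw [coeff_C] at hk
    split_ifs at hk
    · exact hg3.ne hk
    · simp at hk
  have hlead : V (ι g.leadingCoeff) = 1 := by
    by_contra hne
    have hlt : V (ι g.leadingCoeff) < 1 := lt_of_le_of_ne (hg1 _) hne
    refine hmin' g.eraseLead ⟨fun n => ?_, ⟨k, ?_⟩, ?_⟩
      (lt_of_le_of_lt (eraseLead_natDegree_le g) (by omega))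
    · rw [eraseLead_coeff]; split_ifs
      · simp
      · exact hg1 n
    · rw [eraseLead_coeff, if_neg]
      · exact hk
      · rintro rfl; exact hne hk
    · rw [← self_sub_monomial_natDegree_leadingCoeff, _root_.map_sub, aeval_monomial]
      refine V.map_sub_lt hg3 ?_
      rw [map_mul, map_pow]
      exact (mul_le_of_le_one_right' (pow_le_one' hu _)).trans_lt hlt
  have hder1 : ∀ n, V (ι ((derivative g).coeff n)) ≤ 1 := fun n => by
    rw [coeff_derivative, map_mul, map_mul]
    have := hnat (n + 1) n.succ_ne_zero
    push_cast at this
    simp only [map_add, map_natCast, map_one, this, mul_one]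
    exact hg1 _
  have hder : V (aeval u (derivative g)) = 1 := by
    refine le_antisymm (heval _ hder1) (not_lt.1 fun hlt => ?_)
    refine hmin' (derivative g) ⟨hder1, ⟨g.natDegree - 1, ?_⟩, hlt⟩ (natDegree_derivative_lt hpos.ne')
    rw [coeff_derivative, Nat.sub_add_cancel hpos, map_mul, map_mul]
    have := hnat _ hpos.ne'
    have h2 : ((g.natDegree - 1 : ℕ) : D) + 1 = (g.natDegree : D) := by
      rw [← Nat.cast_succ]; congr 1; omega
    rw [h2, map_natCast, this, mul_one]
    exact hlead
  have hsp : (g.map ι).Splits := IsAlgClosed.splits _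
  have hge : g ≠ 0 := by rintro rfl; simp at hpos
  obtain ⟨β, hβ, hlt⟩ : ∃ β ∈ (g.map ι).roots, V (u - β) < 1 := by
    by_contra! hc
    have h1 := hsp.eval_eq_prod_roots u
    have h2 : V ((g.map ι).eval u) < 1 := by rwa [eval_map_algebraMap]
    rw [h1, map_mul, leadingCoeff_map, hlead, one_mul, map_multiset_prod, Multiset.map_map] at h2
    refine absurd h2 (not_lt.2 (Multiset.one_le_prod fun x hx => ?_))
    obtain ⟨β, hβ, rfl⟩ := Multiset.mem_map.1 hx
    exact hc β hβ
  have hroot : aeval β g = 0 := by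
    rw [mem_roots', IsRoot, eval_map_algebraMap] at hβ
    exact hβ.2
  have hβ1 : V β ≤ 1 := by
    have := V.map_sub_le hu hlt.le
    rwa [sub_sub_cancel] at this
  refine ⟨g, β, hg1, hroot, hβ1, ?_, hlt⟩
  have hlt' : V (β - u) < 1 := by rwa [V.map_sub_swap]
  obtain ⟨c, hc1, hc2⟩ := TModel.exists_eval_add_eq V ((derivative g).map ι) (by simpa using hder1)
    u (β - u) hu hlt'.le
  rw [add_sub_cancel, derivative_map, eval_map_algebraMap, eval_map_algebraMap,
    eval_map_algebraMap, add_assoc] at hc2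
  rw [hc2, V.map_add_eq_of_lt_left, hder]
  rw [hder]
  refine V.map_add_lt ?_ ?_
  · rw [map_mul]
    refine (mul_le_of_le_one_left' (heval _ fun n => ?_)).trans_lt hlt'
    rw [coeff_derivative, map_mul, map_mul]
    have := hnat (n + 1) n.succ_ne_zero
    push_cast at this
    simp only [map_add, map_natCast, map_one, this, mul_one]
    exact hder1 _
  · rw [map_mul, map_pow]
    refine (mul_le_of_le_one_left' hc1).trans_lt (pow_lt_one₀ zero_le hlt' two_ne_zero)

end Valuation

theorem exists_map_eq_of_isRoot_map {N Ω : Type*} [Field N] [IsAlgClosed N] [Field Ω]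
    (I : N →+* Ω) {q : N[X]} (hq : q ≠ 0) {x : Ω} (hx : (q.map I).IsRoot x) :
    ∃ β, q.IsRoot β ∧ I β = x := by
  have h1 : x ∈ (q.map I).roots := by
    rw [mem_roots', Polynomial.map_ne_zero_iff I.injective]
    exact ⟨hq, hx⟩
  rw [(IsAlgClosed.splits q).roots_map, Multiset.mem_map] at h1
  obtain ⟨β, hβ, rfl⟩ := h1
  exact ⟨β, (mem_roots'.1 hβ).2, rfl⟩

theorem map_sum_mem_range_of_galois {M Ω N : Type*} [Field M] [Field Ω] [Algebra M Ω]
    [IsGalois M Ω] [Field N] (I : N →+* Ω) (C : Finset N)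
    (h : ∀ σ : Gal(Ω/M), ∀ β ∈ C, ∃ β' ∈ C, σ (I β) = I β') :
    I (∑ β ∈ C, β) ∈ (algebraMap M Ω).fieldRange := by
  classical
  refine (InfiniteGalois.mem_range_algebraMap_iff_fixed _).2 fun σ => ?_
  have hS : (C.image I).image σ = C.image I := by
    refine Finset.eq_of_subset_of_card_le (fun x hx => ?_)
      (Finset.card_image_of_injective _ σ.injective).ge
    simp only [Finset.mem_image, exists_exists_and_eq_and] at hx ⊢
    obtain ⟨β, hβ, rfl⟩ := hx
    obtain ⟨β', hβ', h2⟩ := h σ β hβ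
    exact ⟨β', hβ', h2.symm⟩
  have hsum : I (∑ β ∈ C, β) = ∑ x ∈ C.image I, x := by
    rw [map_sum, Finset.sum_image fun _ _ _ _ h => I.injective h]
  rw [hsum, map_sum, ← Finset.sum_image (f := fun x => x) fun _ _ _ _ h => σ.injective h, hS]

namespace TModel

section Embedding

variable {D M N Ω Γ : Type*} [Field D] [Field M] [Field N] [Field Ω] [Algebra D N] [Algebra M Ω]
  [IsAlgClosed Ω] [Algebra.IsAlgebraic M Ω] [LinearOrderedCommGroupWithZero Γ]
  {w : Valuation Ω Γ} {t : M}

theorem map_mem_range_of_simple_root (h : TModel (w.comap (algebraMap M Ω)) t) {i : D →+* M}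
    {I : N →+* Ω} (hI : ∀ d, I (algebraMap D N d) = algebraMap M Ω (i d)) {g : D[X]}
    (hg : ∀ n, w (I (algebraMap D N (g.coeff n))) ≤ 1) {β : N} (hβ : aeval β g = 0)
    (hβ1 : w (I β) ≤ 1) (hder : w (I (aeval β (derivative g))) = 1) :
    I β ∈ (algebraMap M Ω).fieldRange := by
  have key : ∀ f : D[X], aeval (I β) (f.map i) = I (aeval β f) := fun f => by
    rw [aeval_def, aeval_def, eval₂_map, hom_eval₂]
    congr 1
    ext d
    exact (hI d).symm
  refine h.mem_range_of_simple_root (g.map i) (fun n => ?_) (Algebra.IsIntegral.isIntegral _)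
    (by rw [key, hβ, map_zero]) hβ1 (by rwa [derivative_map, key])
  rw [coeff_map, ← hI]
  exact hg n

omit [Algebra.IsAlgebraic M Ω] in
theorem map_mem_range_of_pow_eq (h : TModel (w.comap (algebraMap M Ω)) t) {x : Ω} {n : ℕ}
    (hn : n ≠ 0) {y : M} (hx : x ^ n = algebraMap M Ω (y ^ n)) :
    x ∈ (algebraMap M Ω).fieldRange := by
  rcases eq_or_ne y 0 with rfl | hy
  · rw [zero_pow hn, map_zero] at hx
    rw [(pow_eq_zero_iff hn).1 hx]
    exact zero_mem _
  have hy' : algebraMap M Ω y ≠ 0 := by simpa using hy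
  have h1 : (x / algebraMap M Ω y) ^ n = algebraMap M Ω 1 := by
    rw [div_pow, hx, map_pow, div_self (pow_ne_zero _ hy'), map_one]
  obtain ⟨m, hm⟩ := h.exists_pow_eq_of_unit hn (by rw [map_one, map_one]) h1
  exact ⟨m * y, by rw [map_mul, hm, div_mul_cancel₀ _ hy']⟩

variable [Algebra.IsAlgebraic D N] [IsAlgClosed N] [IsGalois M Ω]

theorem map_mem_range_of_map_mem_range (h : TModel (w.comap (algebraMap M Ω)) t) {i j : D →+* M}
    {I J : N →+* Ω} (hI : ∀ d, I (algebraMap D N d) = algebraMap M Ω (i d))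
    (hJ : ∀ d, J (algebraMap D N d) = algebraMap M Ω (j d))
    (hIJ : (w.comap I).IsEquiv (w.comap J))
    (hpow : ∀ n : ℕ, n ≠ 0 → ∀ a, (∃ y, i a = y ^ n) → ∃ y, j a = y ^ n) {α : N}
    (hα : I α ∈ (algebraMap M Ω).fieldRange) : J α ∈ (algebraMap M Ω).fieldRange := by
  classical
  set V := w.comap I with hV
  set R : Subfield N := (algebraMap M Ω).fieldRange.comap I ⊓ (algebraMap M Ω).fieldRange.comap J
  have hnat : ∀ n : ℕ, n ≠ 0 → V (n : N) = 1 := fun n hn => by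
    have := h.natCast n hn
    rwa [Valuation.comap_apply, map_natCast, ← map_natCast I] at this
  have hDN : ∀ d, algebraMap D N d ∈ R := fun d => ⟨⟨i d, (hI d).symm⟩, ⟨j d, (hJ d).symm⟩⟩
  -- residues
  have hres : ∀ u, V u = 1 → ∃ r ∈ R, V (u - r) < 1 := fun u hu => by
    obtain ⟨g, β, h1, h2, h3, h4, h5⟩ := V.exists_simple_root_near (D := D) hnat hu.le
    refine ⟨β, ⟨h.map_mem_range_of_simple_root hI h1 h2 h3 h4,
      h.map_mem_range_of_simple_root hJ (g := g) (fun n => ?_) h2 ?_ ?_⟩, h5⟩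
    · exact hIJ.le_one_iff_le_one.1 (h1 n)
    · exact hIJ.le_one_iff_le_one.1 h3
    · exact hIJ.eq_one_iff_eq_one.1 h4
  -- values
  have hval : ∀ γ, γ ≠ 0 → I γ ∈ (algebraMap M Ω).fieldRange → ∃ z ∈ R, V z = V γ := by
    rintro γ hγ ⟨m, hm⟩
    obtain ⟨p, hp0, hp⟩ := Algebra.IsAlgebraic.isAlgebraic (R := D) γ
    obtain ⟨n, hn, b, hb⟩ : ∃ n : ℕ, n ≠ 0 ∧ ∃ b : D, V γ ^ n = V (algebraMap D N b) := by
      rw [aeval_eq_sum_range] at hp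
      simp only [Algebra.smul_def] at hp
      obtain ⟨k, -, l, -, hkl, hk0, hkl'⟩ := V.exists_ne_of_sum_eq_zero hp
        (Finset.self_mem_range_succ _) (mul_ne_zero (by simpa using hp0) (pow_ne_zero _ hγ))
      have hl0 : algebraMap D N (p.coeff l) * γ ^ l ≠ 0 := by
        rw [← V.ne_zero_iff, ← hkl', V.ne_zero_iff]; exact hk0
      have hVγ : V γ ≠ 0 := V.ne_zero_iff.2 hγ
      simp only [map_mul, map_pow] at hkl'
      have key : ∀ k l, k < l → V (algebraMap D N (p.coeff k)) * V γ ^ k =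
          V (algebraMap D N (p.coeff l)) * V γ ^ l → algebraMap D N (p.coeff l) * γ ^ l ≠ 0 →
          ∃ n : ℕ, n ≠ 0 ∧ ∃ b : D, V γ ^ n = V (algebraMap D N b) := fun k l hlt he h0 => by
        have h0' : V (algebraMap D N (p.coeff l)) ≠ 0 := V.ne_zero_iff.2 (left_ne_zero_of_mul h0)
        refine ⟨l - k, by omega, p.coeff k / p.coeff l, ?_⟩
        rw [map_div₀, map_div₀, eq_div_iff h0']
        refine mul_right_cancel₀ (pow_ne_zero k hVγ) ?_
        rw [he, mul_assoc, mul_left_comm, ← pow_add, Nat.sub_add_cancel hlt.le]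
      rcases lt_or_gt_of_ne hkl with hlt | hlt
      · exact key k l hlt hkl' hl0
      · exact key l k hlt hkl'.symm hk0
    have h1 : ∃ y, i b = y ^ n := by
      refine (h.isPow_iff hn _).2 ⟨m, ?_⟩
      rw [Valuation.comap_apply, ← hI, Valuation.comap_apply, map_pow, hm, map_pow]
      exact hb.symm
    obtain ⟨z, hz⟩ := IsAlgClosed.exists_pow_nat_eq (algebraMap D N b) (Nat.pos_of_ne_zero hn)
    refine ⟨z, ⟨?_, ?_⟩, ?_⟩
    · obtain ⟨y, hy⟩ := h1
      exact h.map_mem_range_of_pow_eq hn (y := y) (by rw [← map_pow, hz, hI, hy])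
    · obtain ⟨y, hy⟩ := hpow n hn b h1
      exact h.map_mem_range_of_pow_eq hn (y := y) (by rw [← map_pow, hz, hJ, hy])
    · rw [← hz, map_pow] at hb
      exact ((pow_left_inj₀ zero_le zero_le hn).1 hb).symm
  have hαint : IsIntegral D α := Algebra.IsIntegral.isIntegral α
  let B : Finset N := ((minpoly D α).map (algebraMap D N)).roots.toFinset
  have hBmem : ∀ β, β ∈ B ↔ aeval β (minpoly D α) = 0 := fun β => by
    rw [Multiset.mem_toFinset, mem_roots', IsRoot, eval_map_algebraMap, and_iff_right]
    exact (Polynomial.map_ne_zero_iff (algebraMap D N).injective).2 (minpoly.ne_zero hαint)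
  let S : N → Finset N := fun ε => B.filter fun β => V (β - ε) ≤ V (α - ε)
  have hSmem : ∀ ε β, β ∈ S ε ↔ β ∈ B ∧ V (β - ε) ≤ V (α - ε) := fun ε β => Finset.mem_filter
  have hconj : ∀ (i : D →+* M) (I : N →+* Ω) (_ : ∀ d, I (algebraMap D N d) = algebraMap M Ω (i d))
      (ε : N) (_ : I ε ∈ (algebraMap M Ω).fieldRange) (_ : V.IsEquiv (w.comap I)),
      I (∑ β ∈ S ε, β) ∈ (algebraMap M Ω).fieldRange := by
    rintro i I hI ε ⟨m, hm⟩ hVI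
    refine map_sum_mem_range_of_galois I _ fun σ β hβ => ?_
    rw [hSmem, hBmem] at hβ
    have hr : (((minpoly D α).map (algebraMap D N)).map I).IsRoot (σ (I β)) := by
      have h1 : ((minpoly D α).map (algebraMap D N)).map I =
          ((minpoly D α).map i).map (algebraMap M Ω) := by
        rw [Polynomial.map_map, Polynomial.map_map]
        congr 1
        ext d
        exact hI d
      have h2 : aeval (I β) ((minpoly D α).map i) = 0 := by
        rw [← eval_map_algebraMap, ← h1, eval_map_apply, eval_map_algebraMap, hβ.1, map_zero]
      rw [h1, IsRoot, eval_map_algebraMap]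
      have := aeval_algHom_apply σ.toAlgHom (I β) ((minpoly D α).map i)
      rw [h2, map_zero] at this
      exact this
    obtain ⟨β', hβ', he⟩ := exists_map_eq_of_isRoot_map I
      ((Polynomial.map_ne_zero_iff (algebraMap D N).injective).2 (minpoly.ne_zero hαint)) hr
    rw [IsRoot, eval_map_algebraMap] at hβ'
    refine ⟨β', ?_, he.symm⟩
    rw [hSmem, hBmem]
    refine ⟨hβ', ?_⟩
    rw [hVI _ _] at hβ ⊢
    refine le_trans (le_of_eq ?_) hβ.2
    rw [Valuation.comap_apply, Valuation.comap_apply, map_sub I, map_sub I, he, ← hm]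
    refine h.map_sub_eq_of_minpoly_eq (Algebra.IsIntegral.isIntegral _) ?_ m
    exact minpoly.algEquiv_eq σ (I β)
  obtain ⟨ε, hε, hmin⟩ : ∃ ε, MinimalFor (· ∈ R) (fun ε => (S ε).card) ε :=
    exists_minimalFor_of_wellFoundedLT _ _ ⟨0, zero_mem _⟩
  have hcard : V ((S ε).card : N) = 1 := by
    refine hnat _ (Finset.card_ne_zero_of_mem (a := α) ?_)
    rw [hSmem, hBmem]
    exact ⟨minpoly.aeval _ _, le_rfl⟩
  set ε' := (∑ β ∈ S ε, β) / (S ε).card with hε'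
  have hε'R : ε' ∈ R := by
    refine div_mem ⟨hconj i I hI ε hε.1 Valuation.IsEquiv.refl, hconj j J hJ ε hε.2 hIJ⟩ ?_
    exact natCast_mem _ _
  suffices hαε : α = ε' by rw [hαε]; exact hε'R.2
  by_contra hne
  obtain ⟨z, hz, hzV⟩ := hval (α - ε') (sub_ne_zero.2 hne)
    (by rw [map_sub]; exact sub_mem hα hε'R.1)
  have hz0 : V z ≠ 0 := by rw [hzV, V.ne_zero_iff]; exact sub_ne_zero.2 hne
  obtain ⟨r, hr, hrV⟩ := hres ((α - ε') / z) (by rw [map_div₀, hzV, div_self]; rwa [← hzV])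
  have hρR : ε' + z * r ∈ R := add_mem hε'R (mul_mem hz hr)
  set ρ := ε' + z * r with hρ
  have hαρ : V (α - ρ) < V (α - ε') := by
    have h1 : α - ρ = z * ((α - ε') / z - r) := by
      have : z ≠ 0 := V.ne_zero_iff.1 hz0
      rw [hρ]
      field_simp
      ring
    rw [h1, map_mul, ← hzV]
    exact mul_lt_of_lt_one_right (zero_lt_iff.2 hz0) hrV
  have hεε' : V (ε' - ε) ≤ V (α - ε) :=
    V.map_average_sub_le hcard fun β hβ => ((hSmem _ _).1 hβ).2
  have hle1 : V (α - ε') ≤ V (α - ε) := by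
    have := V.map_sub_le (x := α - ε) (y := ε' - ε) le_rfl hεε'
    rwa [sub_sub_sub_cancel_right] at this
  have hsub : S ρ ⊆ S ε := fun β hβ => by
    rw [hSmem] at hβ ⊢
    refine ⟨hβ.1, ?_⟩
    have h1 : V (β - α) ≤ V (α - ε) := by
      have := V.map_sub_le (hβ.2.trans (hαρ.le.trans hle1)) (hαρ.le.trans hle1)
      rwa [sub_sub_sub_cancel_right] at this
    have := V.map_add_le h1 le_rfl
    rwa [sub_add_sub_cancel] at this
  have heq : S ρ = S ε := Finset.eq_of_subset_of_card_le hsub (hmin hρR (Finset.card_le_card hsub))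
  have h1 : V (ε' - ρ) ≤ V (α - ρ) :=
    V.map_average_sub_le hcard fun β hβ => by
      rw [← heq, hSmem] at hβ
      exact hβ.2
  have h2 := V.map_sub_le le_rfl h1
  rw [sub_sub_sub_cancel_right] at h2
  exact absurd h2 hαρ.not_ge

end Embedding

end TModel

/-- Two embeddings of a field into a valued field `M` with uniformizer `t` inducing the same
valuation and the same sets of `n`-th powers, the source containing a uniformizer. -/
structure Sim {D M Γ : Type*} [Field D] [Field M] [LinearOrderedCommGroupWithZero Γ]
    (v : Valuation M Γ) (t : M) (i j : D →+* M) : Prop where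
  le : ∀ x y, v (i x) ≤ v (i y) ↔ v (j x) ≤ v (j y)
  pow : ∀ n : ℕ, n ≠ 0 → ∀ a, (∃ y, i a = y ^ n) ↔ ∃ y, j a = y ^ n
  unif : ∃ τ, v (i τ) = v t ∧ v (j τ) = v t

theorem AlgebraicClosure.exists_lift {D Ω : Type*} [Field D] [Field Ω] [IsAlgClosed Ω]
    (f : D →+* Ω) : ∃ I : AlgebraicClosure D →+* Ω, ∀ d, I (algebraMap D _ d) = f d := by
  let _ := f.toAlgebra
  exact ⟨(IsAlgClosed.lift : AlgebraicClosure D →ₐ[D] Ω).toRingHom, fun d =>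
    (IsAlgClosed.lift : AlgebraicClosure D →ₐ[D] Ω).commutes d⟩

namespace Sim

theorem symm {D M Γ : Type*} [Field D] [Field M] [LinearOrderedCommGroupWithZero Γ]
    {v : Valuation M Γ} {t : M} {i j : D →+* M} (h : Sim v t i j) : Sim v t j i where
  le x y := (h.le x y).symm
  pow n hn a := (h.pow n hn a).symm
  unif := let ⟨τ, h1, h2⟩ := h.unif; ⟨τ, h2, h1⟩

theorem exists_lift {D M Γ : Type*} [Field D] [Field M] [LinearOrderedCommGroupWithZero Γ]
    {v : Valuation M Γ} {t : M} {i j : D →+* M} (h : Sim v t i j) (hM : TModel v t) :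
    ∃ (W : ValuationSubring (AlgebraicClosure M)) (I J : AlgebraicClosure D →+* AlgebraicClosure M),
      v.IsEquiv (W.valuation.comap (algebraMap M _)) ∧
      (∀ d, I (algebraMap D _ d) = algebraMap M _ (i d)) ∧
      (∀ d, J (algebraMap D _ d) = algebraMap M _ (j d)) ∧
      (W.valuation.comap I).IsEquiv (W.valuation.comap J) := by
  have := hM.charZero
  have : CharZero D := (RingHom.charZero_iff i.injective).2 this
  obtain ⟨W, hW⟩ := Valuation.exists_extension (algebraMap M (AlgebraicClosure M)) v
  obtain ⟨I, hI⟩ := AlgebraicClosure.exists_lift ((algebraMap M (AlgebraicClosure M)).comp i)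
  obtain ⟨J, hJ⟩ := AlgebraicClosure.exists_lift ((algebraMap M (AlgebraicClosure M)).comp j)
  have hle : ∀ m, algebraMap M _ m ∈ W ↔ v m ≤ 1 := fun m => by
    rw [← W.valuation_le_one_iff, ← Valuation.comap_apply, ← hW.le_one_iff_le_one]
  obtain ⟨τ, hτ⟩ := ValuationSubring.exists_algEquiv_of_comap_eq (W.comap I) (W.comap J)
    (D := D) (by
      ext d
      have := h.le d 1
      simp only [map_one] at this
      simp only [ValuationSubring.mem_comap, hI, hJ, RingHom.comp_apply, hle, this])
  refine ⟨W, I, J.comp (τ : AlgebraicClosure D →+* AlgebraicClosure D), hW, hI, fun d => ?_, ?_⟩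
  · rw [RingHom.comp_apply, RingHom.coe_coe, τ.commutes, hJ, RingHom.comp_apply]
  · refine Valuation.isEquiv_iff_val_le_one.2 fun {x} => ?_
    rw [Valuation.comap_apply, Valuation.comap_apply, W.valuation_le_one_iff,
      W.valuation_le_one_iff]
    exact hτ x

theorem exists_relAlgClosed.{u} {D M : Type u} {Γ : Type*} [Field D] [Field M]
    [LinearOrderedCommGroupWithZero Γ] {v : Valuation M Γ} {t : M} {i j : D →+* M}
    (h : Sim v t i j) (hM : TModel v t) :
    ∃ (R : Type u) (_ : Field R) (e : D →+* R) (i' j' : R →+* M), i'.comp e = i ∧ j'.comp e = j ∧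
      Sim v t i' j' ∧ ∀ (x : M) (p : R[X]), p ≠ 0 → eval₂ i' x p = 0 → ∃ r, i' r = x := by
  have := hM.charZero
  obtain ⟨W, I, J, hW, hI, hJ, hIJ⟩ := h.exists_lift hM
  have hM' := hM.congr hW
  set ι := algebraMap M (AlgebraicClosure M)
  have hR : ∀ x, I x ∈ ι.fieldRange ↔ J x ∈ ι.fieldRange := fun x =>
    ⟨hM'.map_mem_range_of_map_mem_range hI hJ hIJ fun n hn a => (h.pow n hn a).1,
      hM'.map_mem_range_of_map_mem_range hJ hI hIJ.symm fun n hn a => (h.pow n hn a).2⟩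
  set R := ι.fieldRange.comap I
  have key : ∀ F : AlgebraicClosure D →+* AlgebraicClosure M, (∀ r ∈ R, F r ∈ ι.fieldRange) →
      ∃ f : R →+* M, ∀ r, ι (f r) = F r := fun F hF => by
    choose f hf using hF
    refine ⟨⟨⟨⟨fun r => f r r.2, ?_⟩, ?_⟩, ?_, ?_⟩, fun r => hf r r.2⟩
    · exact ι.injective (by rw [hf]; simp)
    · exact fun x y => ι.injective (by simp only [map_mul, hf]; simp)
    · exact ι.injective (by simp only [hf]; simp)
    · exact fun x y => ι.injective (by simp only [map_add, hf]; simp)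
  obtain ⟨i', hi'⟩ := key I fun r hr => hr
  obtain ⟨j', hj'⟩ := key J fun r hr => (hR r).1 hr
  have hD : ∀ d, algebraMap D (AlgebraicClosure D) d ∈ R := fun d => ⟨i d, (hI d).symm⟩
  set e : D →+* R := (algebraMap D (AlgebraicClosure D)).codRestrict R hD
  have he : i'.comp e = i := by
    ext d; exact ι.injective (by rw [RingHom.comp_apply, hi']; exact hI d)
  have he' : j'.comp e = j := by
    ext d; exact ι.injective (by rw [RingHom.comp_apply, hj']; exact hJ d)
  have hpow : ∀ (F G : AlgebraicClosure D →+* AlgebraicClosure M) (f g : R →+* M),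
      (∀ r, ι (f r) = F r) → (∀ r, ι (g r) = G r) → (∀ r, F r ∈ ι.fieldRange → r ∈ R) →
      ∀ n : ℕ, n ≠ 0 → ∀ a, (∃ y, f a = y ^ n) → ∃ y, g a = y ^ n := by
    rintro F G f g hf hg hF n hn a ⟨y, hy⟩
    obtain ⟨z, hz⟩ := IsAlgClosed.exists_pow_nat_eq (a : AlgebraicClosure D)
      (Nat.pos_of_ne_zero hn)
    have hzR : z ∈ R := hF z <|
      hM'.map_mem_range_of_pow_eq hn (y := y) (by rw [← map_pow, hz, ← hf, hy])
    refine ⟨g ⟨z, hzR⟩, ι.injective ?_⟩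
    rw [map_pow, hg, hg, ← map_pow, hz]
  refine ⟨R, inferInstance, e, i', j', he, he', ⟨fun x y => ?_, fun n hn a => ⟨?_, ?_⟩, ?_⟩, ?_⟩
  · rw [hW _ _, hW _ _, Valuation.comap_apply, Valuation.comap_apply, Valuation.comap_apply,
      Valuation.comap_apply, hi', hi', hj', hj']
    exact hIJ _ _
  · exact hpow I J i' j' hi' hj' (fun r hr => hr) n hn a
  · exact hpow J I j' i' hj' hi' (fun r hr => (hR r).2 hr) n hn a
  · obtain ⟨τ, h1, h2⟩ := h.unif
    exact ⟨e τ, by rwa [← RingHom.comp_apply, he], by rwa [← RingHom.comp_apply, he']⟩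
  · intro x p hp hx
    obtain ⟨β, -, hβ⟩ := exists_map_eq_of_isRoot_map I
      (q := p.map (algebraMap R (AlgebraicClosure D))) (x := ι x)
      ((Polynomial.map_ne_zero_iff (algebraMap R _).injective).2 hp) (by
        rw [Polynomial.map_map, IsRoot, eval_map]
        have : I.comp (algebraMap R (AlgebraicClosure D)) = ι.comp i' := by
          ext r; exact (hi' r).symm
        rw [this, ← hom_eval₂, hx, map_zero])
    exact ⟨⟨β, x, hβ.symm⟩, ι.injective ((hi' _).trans hβ)⟩

end Sim

/-- The image of the embedding `i` is relatively algebraically closed. -/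
def RingHom.IsRelAlgClosed {E M : Type*} [Field E] [Field M] (i : E →+* M) : Prop :=
  ∀ (x : M) (p : E[X]), p ≠ 0 → eval₂ i x p = 0 → ∃ r, i r = x

theorem RingHom.IsRelAlgClosed.irreducible_map {E M : Type*} [Field E] [Field M] {i : E →+* M}
    (hi : i.IsRelAlgClosed) {p : E[X]} (hp : p.Monic) (hirr : Irreducible p) :
    Irreducible (p.map i) := by
  let _ := i.toAlgebra
  have hlift : ∀ f : M[X], f.Monic → f ∣ p.map i → ∃ g : E[X], g.Monic ∧ g.map i = f := by
    intro f hf hd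
    have := integralClosure.mem_lifts_of_monic_of_dvd_map M hp hf hd
    have hmem : f ∈ lifts i := by
      rw [lifts_iff_coeff_lifts] at this ⊢
      intro n
      obtain ⟨⟨y, q, hq, hqy⟩, hy⟩ := this n
      obtain ⟨r, hr⟩ := hi y q hq.ne_zero hqy
      exact ⟨r, hr.trans hy⟩
    obtain ⟨g, hg1, -, hg2⟩ := lifts_and_natDegree_eq_and_monic hmem hf
    exact ⟨g, hg2, hg1⟩
  have hirr' := hp.irreducible_iff_natDegree.1 hirr
  rw [(hp.map i).irreducible_iff_natDegree]
  refine ⟨fun h1 => hirr'.1 (map_injective i i.injective (by rw [h1, Polynomial.map_one])),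
    fun f g hf hg hfg => ?_⟩
  obtain ⟨f, hf', rfl⟩ := hlift f hf ⟨g, hfg.symm⟩
  obtain ⟨g, hg', rfl⟩ := hlift g hg ⟨_, by rw [← hfg, mul_comm]⟩
  rw [natDegree_map, natDegree_map]
  exact hirr'.2 f g hf' hg' (map_injective i i.injective (by rw [Polynomial.map_mul, hfg]))

namespace TModel

variable {E M Γ : Type*} [Field E] [Field M] [LinearOrderedCommGroupWithZero Γ]
  {v : Valuation M Γ} {t : M} {i : E →+* M}

theorem exists_centers (h : TModel v t) (hi : i.IsRelAlgClosed) (p : E[X]) :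
    ∃ Z : Finset E, ∀ x y : M, (∀ z ∈ Z, v (y - i z) = v (x - i z)) →
      v (eval₂ i y p) = v (eval₂ i x p) := by
  classical
  rcases eq_or_ne p 0 with rfl | hp
  · exact ⟨∅, fun x y _ => by simp⟩
  induction p using UniqueFactorizationMonoid.induction_on_prime with
  | h₁ => exact absurd rfl hp
  | h₂ p hu =>
    obtain ⟨c, -, rfl⟩ := isUnit_iff.1 hu
    exact ⟨∅, fun x y _ => by simp⟩
  | h₃ p q hp0 hq ih =>
    obtain ⟨Z, hZ⟩ := ih hp0
    set q' := q * C q.leadingCoeff⁻¹ with hq'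
    have hqm : q'.Monic := monic_mul_leadingCoeff_inv hq.ne_zero
    have hl : q.leadingCoeff⁻¹ ≠ 0 := inv_ne_zero (leadingCoeff_ne_zero.2 hq.ne_zero)
    have hqi : Irreducible q' := by
      refine (irreducible_mul_isUnit ?_).2 hq.irreducible
      exact isUnit_C.2 hl.isUnit
    have key := h.map_eval_of_irreducible _ (hqm.map i) (hi.irreducible_map hqm hqi)
    set e : E := -(q'.nextCoeff / q'.natDegree) with he
    have he' : -((q'.map i).nextCoeff / ((q'.map i).natDegree : M)) = i e := by
      rw [he, natDegree_map, nextCoeff_map_eq, _root_.map_neg, map_div₀, map_natCast]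
    rw [he'] at key
    refine ⟨insert e Z, fun x y hxy => ?_⟩
    have h1 := hZ x y fun z hz => hxy z (Finset.mem_insert_of_mem hz)
    have h2 := hxy e (Finset.mem_insert_self _ _)
    have h3 : v (eval₂ i y q') = v (eval₂ i x q') := by
      rw [← eval_map, ← eval_map, key, key x, h2]
    have h4 : v (eval₂ i y q) = v (eval₂ i x q) := by
      rw [hq', eval₂_mul, eval₂_mul, eval₂_C, eval₂_C, map_mul, map_mul] at h3
      exact mul_right_cancel₀ (by simpa using hq.ne_zero) h3
    rw [eval₂_mul, eval₂_mul, map_mul, map_mul, h1, h4]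

theorem exists_eq_pow_of_map_eq (h : TModel v t) (hi : i.IsRelAlgClosed) {b : E} {n : ℕ}
    (hn : n ≠ 0) {y : M} (hb : v (i b) = v (y ^ n)) : ∃ z, b = z ^ n := by
  obtain ⟨y, hy⟩ := (h.isPow_iff hn (i b)).2 ⟨y, hb⟩
  obtain ⟨z, rfl⟩ := hi y (X ^ n - C b) (X_pow_sub_C_ne_zero (Nat.pos_of_ne_zero hn) b)
    (by rw [eval₂_sub, eval₂_pow, eval₂_X, eval₂_C, hy, sub_self])
  exact ⟨z, i.injective (by rw [hy, map_pow])⟩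

theorem map_lt_iff (h : TModel v t) {x y : M} : v x < v y ↔ y ≠ 0 ∧ v x ≤ v (t * y) := by
  have ht : v t ≠ 0 := v.ne_zero_iff.2 h.ne_zero
  constructor
  · intro hlt
    have hy : y ≠ 0 := fun h0 => by
      rw [h0, map_zero] at hlt
      exact not_lt_zero hlt
    refine ⟨hy, ?_⟩
    have hy' : 0 < v y := zero_lt_iff.2 (v.ne_zero_iff.2 hy)
    have := h.le_of_lt_one (x / y) (by rwa [map_div₀, div_lt_one₀ hy'])
    rwa [map_div₀, div_le_iff₀ hy', ← map_mul] at this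
  · rintro ⟨hy, hle⟩
    refine hle.trans_lt ?_
    rw [map_mul]
    exact mul_lt_of_lt_one_left (zero_lt_iff.2 (v.ne_zero_iff.2 hy)) h.lt_one

/-- An element of `E` realizing the same cut as `x` relative to `C`, and congruent to it modulo
`N`-th powers. -/
theorem exists_same_cut (h : TModel v t) {τ : E} (hτ : v (i τ) = v t) {x : M}
    (hx : ∀ e, v (i e) ≠ v x) {N : ℕ} (hN : N ≠ 0) (Z : Finset E) (hZ : ∀ z ∈ Z, z ≠ 0) :
    ∃ e : E, e ≠ 0 ∧ (∀ z ∈ Z, (v x < v (i z) → v (i e) < v (i (τ * z))) ∧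
      (v (i z) < v x → v (i z) < v (i e))) ∧ ∃ c, c ≠ 0 ∧ v x = v (i e) * v c ^ N := by
  classical
  wlog hne : Z.Nonempty generalizing Z
  · have hZ0 := Finset.not_nonempty_iff_eq_empty.1 hne
    subst hZ0
    obtain ⟨e, h1, -, h2⟩ := this {1} (by simp) (by simp)
    exact ⟨e, h1, by simp, h2⟩
  have ht := h.ne_zero
  have ht' : v t ≠ 0 := v.ne_zero_iff.2 ht
  have ht0 : 0 < v t := zero_lt_iff.2 ht'
  have hτ0 : τ ≠ 0 := by rintro rfl; rw [map_zero, map_zero] at hτ; exact ht' hτ.symm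
  have hi0 : ∀ {z : E}, z ≠ 0 → v (i z) ≠ 0 := fun hz => by simpa using hz
  have hx0 : x ≠ 0 := by rintro rfl; exact hx 0 (by simp)
  have up : ∀ {z}, v x < v (i z) → v x < v (i (τ * z)) := fun {z} hz => by
    refine lt_of_le_of_ne ?_ (hx _).symm
    rw [map_mul, map_mul, hτ, ← map_mul]
    exact (h.map_lt_iff.1 hz).2
  by_cases hlow : ∃ z ∈ Z, v (i z) < v x
  · obtain ⟨z₀, hz₀, hmax⟩ := Finset.exists_max_image (Z.filter fun z => v (i z) < v x)
      (fun z => v (i z)) (by simpa [Finset.Nonempty] using hlow)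
    rw [Finset.mem_filter] at hz₀
    have hz00 := hZ _ hz₀.1
    have hlt : ∀ k : ℕ, v (i (z₀ / τ ^ k)) < v x := fun k => by
      induction k with
      | zero => simpa using hz₀.2
      | succ k ih =>
        refine lt_of_le_of_ne ?_ (hx _)
        have := (h.map_lt_iff.1 ih).2
        rw [map_mul, ← hτ, mul_comm, ← div_le_iff₀ (by rwa [hτ]), ← map_div₀, ← map_div₀,
          div_div, ← pow_succ] at this
        exact this
    obtain ⟨r, hr, y, hy⟩ := h.div N hN (x / i z₀) (div_ne_zero hx0 (by simpa using hz00))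
    refine ⟨z₀ / τ ^ (N - r), div_ne_zero hz00 (pow_ne_zero _ hτ0), fun z hz => ⟨fun hlt' =>
      (hlt _).trans (up hlt'), fun hlt' => ?_⟩, t * y, ?_, ?_⟩
    · refine (hmax z (Finset.mem_filter.2 ⟨hz, hlt'⟩)).trans_lt ?_
      rw [map_div₀, map_div₀, lt_div_iff₀ (by rw [map_pow, map_pow, hτ]; exact pow_pos ht0 _), map_pow,
        map_pow, hτ]
      exact mul_lt_of_lt_one_right (zero_lt_iff.2 (hi0 hz00))
        (pow_lt_one₀ zero_le h.lt_one (by omega))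
    · refine mul_ne_zero ht ?_
      rintro rfl
      rw [zero_pow hN, mul_zero, map_zero, map_eq_zero, div_eq_zero_iff] at hy
      simp [hx0, hz00] at hy
    · rw [map_div₀, div_eq_iff (hi0 hz00), map_mul, map_pow, map_pow] at hy
      rw [hy, map_div₀, map_div₀, map_pow, map_pow, hτ, map_mul, mul_pow,
        ← pow_mul_pow_sub (v t) hr.le]
      field_simp
  · push Not at hlow
    obtain ⟨z₀, hz₀, hmin⟩ := Finset.exists_min_image Z (fun z => v (i z)) hne
    have hz00 := hZ _ hz₀
    obtain ⟨r, hr, y, hy⟩ := h.div N hN (x / i z₀) (div_ne_zero hx0 (by simpa using hz00))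
    refine ⟨z₀ * τ ^ (r + 2 * N), mul_ne_zero hz00 (pow_ne_zero _ hτ0), fun z hz => ⟨fun _ => ?_,
      fun hlt => absurd hlt (hlow z hz).not_gt⟩, y / t ^ 2, ?_, ?_⟩
    · calc v (i (z₀ * τ ^ (r + 2 * N))) < v (i (τ * z₀)) := by
            rw [mul_comm τ, map_mul, map_mul, map_mul, map_mul, map_pow, map_pow, hτ]
            refine mul_lt_mul_of_pos_left ?_ (zero_lt_iff.2 (hi0 hz00))
            exact pow_lt_self_of_lt_one₀ ht0 h.lt_one (by omega)
        _ ≤ v (i (τ * z)) := by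
            simp only [map_mul]
            exact mul_le_mul_right (hmin z hz) _
    · refine div_ne_zero ?_ (pow_ne_zero _ ht)
      rintro rfl
      rw [zero_pow hN, mul_zero, map_zero, map_eq_zero, div_eq_zero_iff] at hy
      simp [hx0, hz00] at hy
    · rw [map_div₀, div_eq_iff (hi0 hz00), map_mul, map_pow, map_pow] at hy
      rw [hy, map_mul, map_mul, map_pow, map_pow, hτ, map_div₀, div_pow, map_pow, ← pow_mul,
        pow_add]
      field_simp

theorem exists_same_power_cut (h : TModel v t) (hi : i.IsRelAlgClosed) {τ : E}
    (hτ : v (i τ) = v t) {x : M} (hx : ∀ e, v (i e) ≠ v x) {N : ℕ} (hN : N ≠ 0) (B : Finset E)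
    (D : ℕ) : ∃ e : E, e ≠ 0 ∧ (∀ b ∈ B, ∀ d ≤ D, (v x ^ d < v (i b) ↔ v (i e) ^ d < v (i b)) ∧
      (v (i b) < v x ^ d ↔ v (i b) < v (i e) ^ d)) ∧ ∃ c, c ≠ 0 ∧ v x = v (i e) * v c ^ N := by
  classical
  have ht := h.ne_zero
  have ht' : v t ≠ 0 := v.ne_zero_iff.2 ht
  have ht0 : 0 < v t := zero_lt_iff.2 ht'
  have hτ0 : τ ≠ 0 := by rintro rfl; rw [map_zero, map_zero] at hτ; exact ht' hτ.symm
  have hroot : ∀ (b : E) (d : ℕ), b ≠ 0 → d ≠ 0 → ∃ z, z ≠ 0 ∧ v (i z) ^ d * v t ^ d < v (i b) ∧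
      v (i b) ≤ v (i z) ^ d := fun b d hb hd => by
    obtain ⟨r, hr, y, hy⟩ := h.div d hd (i b) (by simpa using hb)
    obtain ⟨z, hz⟩ := h.exists_eq_pow_of_map_eq hi hd (b := b / τ ^ r) (y := y) (by
      rw [map_div₀, map_div₀, hy, map_pow, map_pow, hτ, map_mul, map_pow, map_pow,
        mul_div_cancel_left₀ _ (pow_ne_zero _ ht')])
    rw [div_eq_iff (pow_ne_zero _ hτ0)] at hz
    have hz0 : z ≠ 0 := by
      rintro rfl
      rw [zero_pow hd, zero_mul] at hz
      exact hb hz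
    have hz1 : 0 < v (i z) ^ d := pow_pos (zero_lt_iff.2 (by simpa using hz0)) _
    refine ⟨z, hz0, ?_, ?_⟩
    · rw [hz, map_mul, map_mul, map_pow, map_pow, map_pow, map_pow, hτ]
      exact mul_lt_mul_of_pos_left (pow_lt_pow_right_of_lt_one₀ ht0 h.lt_one hr) hz1
    · rw [hz, map_mul, map_mul, map_pow, map_pow, map_pow, map_pow, hτ]
      exact mul_le_of_le_one_right' (pow_le_one₀ zero_le h.lt_one.le)
  choose! z hz0 hz1 hz2 using hroot
  obtain ⟨e, he0, he, hc⟩ := h.exists_same_cut hτ hx hN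
    (((B.erase 0) ×ˢ Finset.Icc 1 D).image fun q => z q.1 q.2) (by
      intro w hw
      simp only [Finset.mem_image, Finset.mem_product, Finset.mem_erase, Finset.mem_Icc] at hw
      obtain ⟨⟨b, d⟩, ⟨⟨hb, -⟩, hd, -⟩, rfl⟩ := hw
      exact hz0 b d hb (by omega))
  have hx0 : v x ≠ 0 := fun h0 => hx 0 (by rw [h0]; simp)
  have he0' : v (i e) ≠ 0 := by simpa using he0
  refine ⟨e, he0, fun b hb d hd => ?_, hc⟩
  rcases eq_or_ne d 0 with rfl | hd0
  · simp
  rcases eq_or_ne b 0 with rfl | hb0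
  · simp only [map_zero, not_lt_zero, true_and]
    exact iff_of_true (pow_pos (zero_lt_iff.2 hx0) _) (pow_pos (zero_lt_iff.2 he0') _)
  obtain ⟨h1, h2⟩ := he (z b d) (Finset.mem_image.2 ⟨(b, d), by simp; lia, rfl⟩)
  have key : ∀ y : M, v y ≤ v (i (τ * z b d)) → v y ^ d < v (i b) := fun y hy => by
    refine (pow_le_pow_left₀ zero_le hy d).trans_lt ?_
    rw [map_mul, map_mul, mul_pow, mul_comm, hτ]
    exact hz1 b d hb0 hd0
  have key' : ∀ y : M, v (i (z b d)) < v y → v (i b) < v y ^ d := fun y hy =>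
    (hz2 b d hb0 hd0).trans_lt (pow_lt_pow_left₀ hy zero_le hd0)
  rcases lt_or_gt_of_ne (hx (z b d)) with hlt | hlt
  · have a1 := key' _ hlt
    have a2 := key' _ (h2 hlt)
    exact ⟨iff_of_false a1.not_gt a2.not_gt, iff_of_true a1 a2⟩
  · have a1 := key x (by rw [map_mul, map_mul, hτ, ← map_mul]; exact (h.map_lt_iff.1 hlt).2)
    have a2 := key _ (h1 hlt).le
    exact ⟨iff_of_true a1 a2, iff_of_false a1.not_gt a2.not_gt⟩

theorem exists_approx_of_value (h : TModel v t) (hi : i.IsRelAlgClosed) {τ : E}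
    (hτ : v (i τ) = v t) {x : M} (hx : ∀ e, v (i e) ≠ v x) {N : ℕ} (hN : N ≠ 0)
    (F : Finset E[X]) : ∃ e : E,
      (∀ p ∈ F, ∀ q ∈ F, v (eval₂ i x p) ≤ v (eval₂ i x q) ↔
        v (i (p.eval e)) ≤ v (i (q.eval e))) ∧
      ∀ p ∈ F, ∃ c, c ≠ 0 ∧ v (eval₂ i x p) = v (i (p.eval e)) * v c ^ N := by
  classical
  set D := F.sup natDegree with hD
  set K := Finset.range (D + 1) with hK
  obtain ⟨e, he0, he, c, hc0, hc⟩ := h.exists_same_power_cut hi hτ hx hN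
    (((F ×ˢ K) ×ˢ (F ×ˢ K)).image fun r => r.1.1.coeff r.1.2 / r.2.1.coeff r.2.2) D
  have hx0 : 0 < v x := zero_lt_iff.2 fun h0 => hx 0 (by rw [h0]; simp)
  have he0' : 0 < v (i e) := zero_lt_iff.2 (by simpa using he0)
  have hpow : ∀ (n : ℕ) (b : E), n ≠ 0 → v x ^ n ≠ v (i b) := fun n b hn hb => by
    rw [← map_pow] at hb
    obtain ⟨z, rfl⟩ := h.exists_eq_pow_of_map_eq hi hn hb.symm
    rw [map_pow, map_pow, map_pow] at hb
    exact hx z ((pow_left_inj₀ zero_le zero_le hn).1 hb).symm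
  -- comparison of monomials
  have transfer : ∀ p ∈ F, ∀ q ∈ F, ∀ k ∈ K, ∀ l ∈ K,
      v (i (p.coeff k)) * v x ^ k < v (i (q.coeff l)) * v x ^ l ↔
      v (i (p.coeff k)) * v (i e) ^ k < v (i (q.coeff l)) * v (i e) ^ l := by
    intro p hp q hq k hk l hl
    have hk' := Finset.mem_range.1 hk
    have hl' := Finset.mem_range.1 hl
    rcases eq_or_ne (q.coeff l) 0 with hq0 | hq0
    · simp [hq0]
    have hq1 : 0 < v (i (q.coeff l)) := zero_lt_iff.2 (by simpa using hq0)
    rcases eq_or_ne (p.coeff k) 0 with hp0 | hp0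
    · simp only [hp0, map_zero, zero_mul]
      exact iff_of_true (mul_pos hq1 (pow_pos hx0 _)) (mul_pos hq1 (pow_pos he0' _))
    have hp1 : 0 < v (i (p.coeff k)) := zero_lt_iff.2 (by simpa using hp0)
    have aux : ∀ (a b γ : Γ) (m n : ℕ), 0 < γ → 0 < b → m ≤ n →
        (a * γ ^ m < b * γ ^ n ↔ a / b < γ ^ (n - m)) := fun a b γ m n hγ hb hmn => by
      rw [div_lt_iff₀ hb, ← pow_sub_mul_pow γ hmn, ← mul_assoc, mul_comm b,
        mul_lt_mul_iff_left₀ (pow_pos hγ _)]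
    have aux' : ∀ (a b γ : Γ) (m n : ℕ), 0 < γ → 0 < a → n ≤ m →
        (a * γ ^ m < b * γ ^ n ↔ γ ^ (m - n) < b / a) := fun a b γ m n hγ ha hmn => by
      rw [lt_div_iff₀ ha, ← pow_sub_mul_pow γ hmn, ← mul_assoc, mul_comm a,
        mul_lt_mul_iff_left₀ (pow_pos hγ _)]
    rcases le_total k l with hkl | hkl
    · rw [aux _ _ _ _ _ hx0 hq1 hkl, aux _ _ _ _ _ he0' hq1 hkl, ← map_div₀, ← map_div₀]
      exact (he _ (Finset.mem_image.2 ⟨((p, k), (q, l)), by simp [hp, hq, hk, hl], rfl⟩) _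
        (by omega)).2
    · rw [aux' _ _ _ _ _ hx0 hp1 hkl, aux' _ _ _ _ _ he0' hp1 hkl, ← map_div₀, ← map_div₀]
      exact (he _ (Finset.mem_image.2 ⟨((q, l), (p, k)), by simp [hp, hq, hk, hl], rfl⟩) _
        (by omega)).1
  have dom : ∀ p ∈ F, ∃ s ∈ K, v (eval₂ i x p) = v (i (p.coeff s)) * v x ^ s ∧
      v (i (p.eval e)) = v (i (p.coeff s)) * v (i e) ^ s := by
    intro p hp
    have hsum : ∀ y : M, eval₂ i y p = ∑ k ∈ K, i (p.coeff k) * y ^ k := fun y =>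
      eval₂_eq_sum_range' i (Nat.lt_succ_of_le (Finset.le_sup hp)) y
    obtain ⟨s, hs, hmax⟩ := Finset.exists_max_image K (fun k => v (i (p.coeff k)) * v x ^ k)
      (by simp [hK])
    rcases eq_or_ne (p.coeff s) 0 with hs0 | hs0
    · have hp0 : p = 0 := by
        ext k
        rw [coeff_zero]
        by_cases hk : k ∈ K
        · have := hmax k hk
          simp only [hs0, map_zero, zero_mul, nonpos_iff_eq_zero, mul_eq_zero] at this
          simpa [hx0.ne'] using this
        · refine coeff_eq_zero_of_natDegree_lt ?_
          rw [hK, Finset.mem_range] at hk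
          exact lt_of_le_of_lt (Finset.le_sup hp) (by omega)
      subst hp0
      exact ⟨s, hs, by simp⟩
    have hstrict : ∀ k ∈ K, k ≠ s → v (i (p.coeff k)) * v x ^ k < v (i (p.coeff s)) * v x ^ s := by
      intro k hk hks
      refine lt_of_le_of_ne (hmax k hk) fun heq => ?_
      have hs1 : v (i (p.coeff s)) ≠ 0 := by simpa using hs0
      have hk0 : p.coeff k ≠ 0 := fun h0 => by
        rw [h0, map_zero, map_zero, zero_mul] at heq
        exact mul_ne_zero hs1 (pow_ne_zero _ hx0.ne') heq.symm
      have hk1 : v (i (p.coeff k)) ≠ 0 := by simpa using hk0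
      rcases lt_or_gt_of_ne hks with hlt | hlt
      · refine hpow (s - k) (p.coeff k / p.coeff s) (by omega) ?_
        rw [map_div₀, map_div₀, eq_div_iff hs1]
        refine mul_right_cancel₀ (pow_ne_zero k hx0.ne') ?_
        rw [heq, ← pow_sub_mul_pow (v x) hlt.le]
        ac_rfl
      · refine hpow (k - s) (p.coeff s / p.coeff k) (by omega) ?_
        rw [map_div₀, map_div₀, eq_div_iff hk1]
        refine mul_right_cancel₀ (pow_ne_zero s hx0.ne') ?_
        rw [← heq, ← pow_sub_mul_pow (v x) hlt.le]
        ac_rfl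
    refine ⟨s, hs, ?_, ?_⟩
    · rw [hsum, v.map_sum_eq_of_lt hs, map_mul, map_pow]
      intro k hk
      simp only [Finset.mem_sdiff, Finset.mem_singleton] at hk
      simpa only [map_mul, map_pow] using hstrict k hk.1 hk.2
    · rw [← eval₂_at_apply, hsum, v.map_sum_eq_of_lt hs, map_mul, map_pow]
      intro k hk
      simp only [Finset.mem_sdiff, Finset.mem_singleton] at hk
      simpa only [map_mul, map_pow] using (transfer p hp p hp k hk.1 s hs).1 (hstrict k hk.1 hk.2)
  refine ⟨e, fun p hp q hq => ?_, fun p hp => ?_⟩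
  · obtain ⟨k, hk, hk1, hk2⟩ := dom p hp
    obtain ⟨l, hl, hl1, hl2⟩ := dom q hq
    rw [hk1, hk2, hl1, hl2, ← not_lt, ← not_lt, transfer q hq p hp l hl k hk]
  · obtain ⟨s, hs, h1, h2⟩ := dom p hp
    refine ⟨c ^ s, pow_ne_zero _ hc0, ?_⟩
    rw [h1, h2, map_pow, hc]
    rw [mul_pow, mul_assoc, ← pow_mul, ← pow_mul, mul_comm N s]

theorem exists_approx (h : TModel v t) (hi : i.IsRelAlgClosed) {τ : E}
    (hτ : v (i τ) = v t) {x : M} (hx : ∀ e, i e ≠ x) {N : ℕ} (hN : N ≠ 0)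
    (F : Finset E[X]) : ∃ e : E,
      (∀ p ∈ F, ∀ q ∈ F, v (eval₂ i x p) ≤ v (eval₂ i x q) ↔
        v (i (p.eval e)) ≤ v (i (q.eval e))) ∧
      ∀ p ∈ F, ∃ c, c ≠ 0 ∧ v (eval₂ i x p) = v (i (p.eval e)) * v c ^ N := by
  classical
  choose Z hZ using h.exists_centers hi
  have reduce : (∃ e : E, ∀ z ∈ F.biUnion Z, v (i e - i z) = v (x - i z)) → ∃ e : E,
      (∀ p ∈ F, ∀ q ∈ F, v (eval₂ i x p) ≤ v (eval₂ i x q) ↔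
        v (i (p.eval e)) ≤ v (i (q.eval e))) ∧
      ∀ p ∈ F, ∃ c, c ≠ 0 ∧ v (eval₂ i x p) = v (i (p.eval e)) * v c ^ N := by
    rintro ⟨e, he⟩
    have key : ∀ p ∈ F, v (eval₂ i x p) = v (i (p.eval e)) := fun p hp => by
      rw [← eval₂_at_apply]
      exact (hZ p x (i e) fun z hz => he z (Finset.mem_biUnion.2 ⟨p, hp, hz⟩)).symm
    exact ⟨e, fun p hp q hq => by rw [key p hp, key q hq], fun p hp => ⟨1, one_ne_zero, by
      rw [key p hp, map_one, one_pow, mul_one]⟩⟩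
  by_cases hbest : ∃ e₀, ∀ e, v (x - i e₀) ≤ v (x - i e)
  · obtain ⟨e₀, he₀⟩ := hbest
    have hxe : x - i e₀ ≠ 0 := sub_ne_zero.2 (hx e₀).symm
    by_cases hval : ∃ c, v (i c) = v (x - i e₀)
    · obtain ⟨c, hc⟩ := hval
      refine reduce ?_
      have hc0 : v (i c) ≠ 0 := by rwa [hc, v.ne_zero_iff]
      have hfin : ∀ z : E, {m : ℕ | v (i (m : E) - i ((z - e₀) / c)) < 1}.Finite := by
        refine fun z => Set.Subsingleton.finite fun m hm m' hm' => ?_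
        have hlt : v ((m : M) - m') < 1 := by
          have := v.map_sub_lt hm hm'
          simpa using this
        by_contra hne
        rcases lt_or_gt_of_ne hne with h1 | h1
        · rw [v.map_sub_swap, ← Nat.cast_sub h1.le, h.natCast _ (by omega)] at hlt
          exact lt_irrefl _ hlt
        · rw [← Nat.cast_sub h1.le, h.natCast _ (by omega)] at hlt
          exact lt_irrefl _ hlt
      obtain ⟨m, hm⟩ := (((F.biUnion Z).finite_toSet.biUnion fun z _ => hfin z).union
        (Set.finite_singleton 0)).infinite_compl.nonempty
      simp only [Set.mem_compl_iff, Set.mem_union, Set.mem_iUnion, Set.mem_singleton_iff,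
        not_or, not_exists, Set.mem_ofPred_eq, not_lt, Finset.mem_coe] at hm
      refine ⟨e₀ + c * m, fun z hz => ?_⟩
      have hcm : v (i (c * m)) = v (x - i e₀) := by
        rw [map_mul, map_mul, hc, map_natCast, h.natCast m hm.2, mul_one]
      have e1 : i (e₀ + c * m) - i z = i (c * m) - i (z - e₀) := by
        simp only [map_add, _root_.map_sub]; ring
      have e2 : x - i z = (x - i e₀) - i (z - e₀) := by rw [_root_.map_sub]; ring
      rw [e1, e2]
      rcases lt_trichotomy (v (i (z - e₀))) (v (x - i e₀)) with hlt | heq | hlt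
      · rw [v.map_sub_eq_of_lt_left hlt, v.map_sub_eq_of_lt_left (by rwa [hcm]), hcm]
      · have a1 : v ((x - i e₀) - i (z - e₀)) = v (x - i e₀) := by
          refine le_antisymm ((v.map_sub _ _).trans (by rw [heq, max_self])) ?_
          rw [← e2]
          exact he₀ z
        have a2 : v (i (c * m) - i (z - e₀)) = v (x - i e₀) := by
          refine le_antisymm ((v.map_sub _ _).trans (by rw [heq, hcm, max_self])) ?_
          have := hm.1 z hz
          have hc1 : c ≠ 0 := by rintro rfl; simp at hc0
          calc v (x - i e₀) = v (i c) * 1 := by rw [hc, mul_one]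
            _ ≤ v (i c) * v (i (m : E) - i ((z - e₀) / c)) := mul_le_mul_right this _
            _ = _ := by rw [← map_mul, mul_sub, ← map_mul, ← map_mul, mul_div_cancel₀ _ hc1]
        rw [a1, a2]
      · rw [v.map_sub_eq_of_lt_right hlt, v.map_sub_eq_of_lt_right (by rwa [hcm])]
    · push Not at hval
      obtain ⟨e, h1, h2⟩ := h.exists_approx_of_value hi hτ hval hN
        (F.image fun p => p.comp (X + C e₀))
      have key : ∀ p : E[X], eval₂ i (x - i e₀) (p.comp (X + C e₀)) = eval₂ i x p := fun p => by
        rw [eval₂_comp, eval₂_add, eval₂_X, eval₂_C, sub_add_cancel]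
      have key' : ∀ p : E[X], (p.comp (X + C e₀)).eval e = p.eval (e + e₀) := fun p => by
        rw [eval_comp, eval_add, eval_X, eval_C]
      refine ⟨e + e₀, fun p hp q hq => ?_, fun p hp => ?_⟩
      · have := h1 _ (Finset.mem_image_of_mem _ hp) _ (Finset.mem_image_of_mem _ hq)
        rwa [key, key, key', key'] at this
      · have := h2 _ (Finset.mem_image_of_mem _ hp)
        rwa [key, key'] at this
  · push Not at hbest
    refine reduce ?_
    have hfin : ∀ Y : Finset E, ∃ e, ∀ z ∈ Y, v (x - i e) < v (x - i z) := by
      intro Y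
      induction Y using Finset.induction_on with
      | empty => exact ⟨0, by simp⟩
      | insert z Y hz ih =>
        obtain ⟨e, he⟩ := ih
        rcases le_total (v (x - i e)) (v (x - i z)) with hle | hle
        · obtain ⟨e', he'⟩ := hbest e
          refine ⟨e', fun y hy => ?_⟩
          rcases Finset.mem_insert.1 hy with rfl | hy
          · exact he'.trans_le hle
          · exact he'.trans (he y hy)
        · obtain ⟨e', he'⟩ := hbest z
          refine ⟨e', fun y hy => ?_⟩
          rcases Finset.mem_insert.1 hy with rfl | hy
          · exact he'
          · exact (he'.trans_le hle).trans (he y hy)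
    obtain ⟨e, he⟩ := hfin (F.biUnion Z)
    refine ⟨e, fun z hz => ?_⟩
    have : i e - i z = (x - i z) - (x - i e) := by ring
    rw [this, v.map_sub_eq_of_lt_left (he z hz)]

end TModel

namespace LVR

/-- The symbol `0`. -/
def zeroSymb : LVR.Functions 0 := LVRFunc.zero

/-- The symbol `1`. -/
def oneSymb : LVR.Functions 0 := LVRFunc.one

/-- The symbol `+`. -/
def addSymb : LVR.Functions 2 := LVRFunc.add

/-- The symbol `×`. -/
def mulSymb : LVR.Functions 2 := LVRFunc.mul

/-- The symbol `|`. -/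
def dvdSymb : LVR.Relations 2 := LVRRel.dvd

/-- The symbol `N`. -/
def unifSymb : LVR.Relations 1 := LVRRel.N

/-- The symbol `P_m`. -/
def powSymb (m : ℕ+) : LVR.Relations 1 := LVRRel.pow m

end LVR

/-- The `LVR`-structure on `M` is the one given by the ring operations, the valuation `v` and the
uniformizer `t`. -/
structure IsValuedStructure {M Γ : Type*} [Field M] [LVR.Structure M]
    [LinearOrderedCommGroupWithZero Γ] (v : Valuation M Γ) (t : M) : Prop where
  zero : ∀ x : Fin 0 → M, Language.Structure.funMap LVR.zeroSymb x = 0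
  one : ∀ x : Fin 0 → M, Language.Structure.funMap LVR.oneSymb x = 1
  add : ∀ x : Fin 2 → M, Language.Structure.funMap LVR.addSymb x = x 0 + x 1
  mul : ∀ x : Fin 2 → M, Language.Structure.funMap LVR.mulSymb x = x 0 * x 1
  dvd : ∀ x : Fin 2 → M, Language.Structure.RelMap LVR.dvdSymb x ↔ v (x 1) ≤ v (x 0)
  N : ∀ x : Fin 1 → M, Language.Structure.RelMap LVR.unifSymb x ↔ v (x 0) = v t
  pow : ∀ (m : ℕ+) (x : Fin 1 → M),
    Language.Structure.RelMap (LVR.powSymb m) x ↔ ∃ y, x 0 = y ^ (m : ℕ)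

theorem ValuationSubring.valuation_le_iff_div_mem {F : Type*} [Field F] (B : ValuationSubring F)
    {x y : F} (hy : y ≠ 0) : B.valuation x ≤ B.valuation y ↔ x / y ∈ B := by
  rw [← B.valuation_le_one_iff, map_div₀, div_le_one₀ (by simpa [zero_lt_iff] using hy)]

section Ultrapower

open Filter

variable {M I : Type*} [Field M] (A : ValuationSubring M) (u : Ultrafilter I)

/-- The valuation ring of the ultrapower of a valued field. -/
def ValuationSubring.ultrapower : ValuationSubring (Germ (u : Filter I) M) where
  carrier := {x | ∃ f : I → M, (f : Germ (u : Filter I) M) = x ∧ ∀ i, f i ∈ A}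
  mul_mem' := by
    rintro _ _ ⟨f, rfl, hf⟩ ⟨g, rfl, hg⟩
    exact ⟨f * g, rfl, fun i => A.mul_mem _ _ (hf i) (hg i)⟩
  one_mem' := ⟨1, rfl, fun i => A.one_mem⟩
  add_mem' := by
    rintro _ _ ⟨f, rfl, hf⟩ ⟨g, rfl, hg⟩
    exact ⟨f + g, rfl, fun i => A.add_mem _ _ (hf i) (hg i)⟩
  zero_mem' := ⟨0, rfl, fun i => A.zero_mem⟩
  neg_mem' := by
    rintro _ ⟨f, rfl, hf⟩
    exact ⟨-f, rfl, fun i => A.neg_mem _ (hf i)⟩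
  mem_or_inv_mem' x := by
    induction x using Germ.inductionOn with | _ f => ?_
    rcases u.em fun i => f i ∈ A with h | h
    · left
      classical
      refine ⟨fun i => if f i ∈ A then f i else 0, Germ.coe_eq.2 ?_, fun i => ?_⟩
      · filter_upwards [h] with i hi
        rw [if_pos hi]
      · dsimp only
        split_ifs with hi
        · exact hi
        · exact A.zero_mem
    · right
      classical
      refine ⟨fun i => if f i ∈ A then 0 else (f i)⁻¹, Germ.coe_eq.2 ?_, fun i => ?_⟩
      · filter_upwards [h] with i hi
        rw [if_neg hi]
        rfl
      · dsimp only
        split_ifs with hi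
        · exact A.zero_mem
        · exact (A.mem_or_inv_mem (f i)).resolve_left hi

theorem ValuationSubring.coe_mem_ultrapower (f : I → M) :
    (f : Germ (u : Filter I) M) ∈ A.ultrapower u ↔ ∀ᶠ i in u, f i ∈ A := by
  constructor
  · rintro ⟨g, hg, h⟩
    filter_upwards [Germ.coe_eq.1 hg] with i hi
    rw [← hi]
    exact h i
  · intro h
    classical
    refine ⟨fun i => if f i ∈ A then f i else 0, Germ.coe_eq.2 ?_, fun i => ?_⟩
    · filter_upwards [h] with i hi
      rw [if_pos hi]
    · dsimp only
      split_ifs with hi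
      · exact hi
      · exact A.zero_mem

theorem ValuationSubring.valuation_ultrapower_le (f g : I → M) :
    (A.ultrapower u).valuation (f : Germ (u : Filter I) M) ≤ (A.ultrapower u).valuation ↑g ↔
      ∀ᶠ i in u, A.valuation (f i) ≤ A.valuation (g i) := by
  rcases u.em fun i => g i = 0 with h | h
  · have hg : (g : Germ (u : Filter I) M) = 0 := Germ.coe_eq.2 h
    rw [hg, map_zero, nonpos_iff_eq_zero, map_eq_zero]
    have : (f : Germ (u : Filter I) M) = 0 ↔ ∀ᶠ i in u, f i = 0 := Germ.coe_eq
    rw [this]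
    refine eventually_congr (h.mono fun i hi => ?_)
    rw [hi, map_zero, nonpos_iff_eq_zero, map_eq_zero]
  · have hg : (g : Germ (u : Filter I) M) ≠ 0 := fun h0 => by
      obtain ⟨i, hi, hi'⟩ := (h.and (Germ.coe_eq.1 h0)).exists
      exact hi hi'
    rw [ValuationSubring.valuation_le_iff_div_mem _ hg]
    refine (A.coe_mem_ultrapower u (f / g)).trans (eventually_congr (h.mono fun i hi => ?_))
    exact (A.valuation_le_iff_div_mem hi).symm

theorem Filter.Germ.exists_eq_pow_iff (f : I → M) (n : ℕ) :
    (∃ y, (f : Germ (u : Filter I) M) = y ^ n) ↔ ∀ᶠ i in u, ∃ y, f i = y ^ n := by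
  constructor
  · rintro ⟨y, hy⟩
    induction y using Germ.inductionOn with | _ g => ?_
    filter_upwards [(Germ.coe_eq (g := g ^ n)).1 hy] with i hi
    exact ⟨g i, hi⟩
  · intro h
    classical
    choose! g hg using fun (i : I) (hi : ∃ y, f i = y ^ n) => hi
    exact ⟨g, Germ.coe_eq.2 (h.mono hg)⟩

/-- The `LVR`-structure on an ultrapower. -/
noncomputable instance Filter.Germ.instStructure [LVR.Structure M] :
    LVR.Structure (Germ (u : Filter I) M) :=
  inferInstanceAs (LVR.Structure ((u : Filter I).Product fun _ => M))

theorem Filter.Germ.realize_coe [LVR.Structure M] {β : Type*} {n : ℕ}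
    (φ : LVR.BoundedFormula β n) (x : β → I → M) (y : Fin n → I → M) :
    φ.Realize (fun b => (x b : Germ (u : Filter I) M)) (fun k => (y k : Germ (u : Filter I) M)) ↔
      ∀ᶠ i in u, φ.Realize (fun b => x b i) fun k => y k i :=
  Language.Ultraproduct.boundedFormula_realize_cast φ x y

theorem Filter.Germ.elementarilyEquivalent [LVR.Structure M] :
    M ≅[LVR] Germ (u : Filter I) M := by
  rw [Language.elementarilyEquivalent_iff]
  intro φ
  refine Iff.trans ?_ (Language.Ultraproduct.sentence_realize (M := fun _ => M) (u := u) φ).symm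
  rw [eventually_const]

variable {A} in
theorem IsValuedStructure.ultrapower [LVR.Structure M] {t : M}
    (h : IsValuedStructure A.valuation t) :
    IsValuedStructure (A.ultrapower u).valuation ((fun _ => t : I → M) : Germ (u : Filter I) M) := by
  have lift : ∀ {n : ℕ} (x : Fin n → Germ (u : Filter I) M),
      ∃ y : Fin n → I → M, x = fun k => (y k : Germ (u : Filter I) M) := fun x => by
    choose y hy using fun k => Quotient.exists_rep (x k)
    exact ⟨y, funext fun k => (hy k).symm⟩
  have hfun : ∀ {n : ℕ} (f : LVR.Functions n) (y : Fin n → I → M),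
      Language.Structure.funMap f (fun k => (y k : Germ (u : Filter I) M)) =
      ((fun i => Language.Structure.funMap f fun k => y k i : I → M) : Germ (u : Filter I) M) :=
    fun f y => Language.Ultraproduct.funMap_cast (M := fun _ => M) (u := u) f y
  have hrel : ∀ {n : ℕ} (r : LVR.Relations n) (y : Fin n → I → M),
      Language.Structure.RelMap r (fun k => (y k : Germ (u : Filter I) M)) ↔
      ∀ᶠ i in u, Language.Structure.RelMap r fun k => y k i := fun r y =>
    Language.relMap_quotient_mk' ((u : Filter I).productSetoid fun _ => M) r y
  refine ⟨fun x => ?_, fun x => ?_, fun x => ?_, fun x => ?_, fun x => ?_, fun x => ?_,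
    fun m x => ?_⟩ <;> obtain ⟨y, rfl⟩ := lift x
  · rw [hfun _ y]; simp only [h.zero]; rfl
  · rw [hfun _ y]; simp only [h.one]; rfl
  · rw [hfun _ y]; simp only [h.add]; rfl
  · rw [hfun _ y]; simp only [h.mul]; rfl
  · rw [hrel _ y]; simp only [h.dvd, A.valuation_ultrapower_le]
  · rw [hrel _ y]; simp only [h.N, le_antisymm_iff, A.valuation_ultrapower_le, eventually_and]
  · rw [hrel _ y]; simp only [h.pow, Filter.Germ.exists_eq_pow_iff]

end Ultrapower

theorem Sim.of_isDomain {R M Γ : Type*} [CommRing R] [IsDomain R] [Field M]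
    [LinearOrderedCommGroupWithZero Γ] {v : Valuation M Γ} {t : M} {f g : R →+* M}
    (hf : Function.Injective f) (hle : ∀ p q, v (f p) ≤ v (f q) ↔ v (g p) ≤ v (g q))
    (hpow : ∀ n : ℕ, n ≠ 0 → ∀ p, (∃ y, f p = y ^ n) ↔ ∃ y, g p = y ^ n)
    (hunif : ∃ τ, v (f τ) = v t ∧ v (g τ) = v t) :
    ∃ i j : FractionRing R →+* M, (∀ r, i (algebraMap R _ r) = f r) ∧
      (∀ r, j (algebraMap R _ r) = g r) ∧ Sim v t i j := by
  have hg : Function.Injective g := by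
    rw [injective_iff_map_eq_zero] at hf ⊢
    intro p hp
    have := (hle p 0).2 (by simp [hp])
    rw [map_zero, map_zero, nonpos_iff_eq_zero, map_eq_zero] at this
    exact hf p this
  set i : FractionRing R →+* M := IsFractionRing.lift hf with hi
  set j : FractionRing R →+* M := IsFractionRing.lift hg with hj
  have hi' : ∀ r, i (algebraMap R _ r) = f r := IsFractionRing.lift_algebraMap hf
  have hj' : ∀ r, j (algebraMap R _ r) = g r := IsFractionRing.lift_algebraMap hg
  have pos : ∀ (k : R →+* M), Function.Injective k → ∀ {q}, q ≠ 0 → 0 < v (k q) :=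
    fun k hk q hq => zero_lt_iff.2 (v.ne_zero_iff.2 (by rwa [Ne, map_eq_zero_iff k hk]))
  refine ⟨i, j, hi', hj', fun x y => ?_, fun n hn x => ?_, ?_⟩
  · obtain ⟨p, q, hq, rfl⟩ := IsFractionRing.div_surjective (A := R) x
    obtain ⟨p', q', hq', rfl⟩ := IsFractionRing.div_surjective (A := R) y
    have hq := nonZeroDivisors.ne_zero hq
    have hq' := nonZeroDivisors.ne_zero hq'
    simp only [map_div₀, hi', hj']
    rw [div_le_div_iff₀ (pos f hf hq) (pos f hf hq'), div_le_div_iff₀ (pos g hg hq) (pos g hg hq')]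
    simpa only [map_mul] using hle (p * q') (p' * q)
  · obtain ⟨p, q, hq, rfl⟩ := IsFractionRing.div_surjective (A := R) x
    have hq := nonZeroDivisors.ne_zero hq
    have key : ∀ k : R →+* M, Function.Injective k →
        ((∃ y, k p / k q = y ^ n) ↔ ∃ y, k (p * q ^ (n - 1)) = y ^ n) := fun k hk => by
      have hq0 : k q ≠ 0 := by rwa [Ne, map_eq_zero_iff k hk]
      have hqn : k q ^ n = k q ^ (n - 1) * k q := by
        rw [← pow_succ, Nat.sub_add_cancel (Nat.one_le_iff_ne_zero.2 hn)]
      constructor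
      · rintro ⟨y, hy⟩
        refine ⟨y * k q, ?_⟩
        rw [mul_pow, ← hy, hqn, map_mul, map_pow]
        field_simp
      · rintro ⟨y, hy⟩
        refine ⟨y / k q, ?_⟩
        rw [div_pow, ← hy, hqn, map_mul, map_pow]
        field_simp
    simp only [map_div₀, hi', hj']
    rw [key f hf, key g hg]
    exact hpow n hn _
  · obtain ⟨τ, h1, h2⟩ := hunif
    exact ⟨algebraMap R _ τ, by rwa [hi'], by rwa [hj']⟩

theorem TModel.isPow_congr {M Γ : Type*} [Field M] [LinearOrderedCommGroupWithZero Γ]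
    {v : Valuation M Γ} {t : M} (h : TModel v t) {a b c : M} (hc : c ≠ 0) {n N : ℕ} (hn : n ≠ 0)
    (hnN : n ∣ N) (hab : v a = v b * v c ^ N) : (∃ y, a = y ^ n) ↔ ∃ y, b = y ^ n := by
  obtain ⟨k, rfl⟩ := hnN
  have hc' : v c ^ k ≠ 0 := pow_ne_zero _ (v.ne_zero_iff.2 hc)
  rw [h.isPow_iff hn, h.isPow_iff hn, hab, mul_comm n k, pow_mul]
  constructor
  · rintro ⟨y, hy⟩
    refine ⟨y / c ^ k, ?_⟩
    rw [map_pow, map_div₀, div_pow, map_pow v c, ← map_pow, ← hy,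
      mul_div_cancel_right₀ _ (pow_ne_zero _ hc')]
  · rintro ⟨y, hy⟩
    exact ⟨y * c ^ k, by rw [hy, map_pow, map_pow, map_mul, mul_pow, map_pow]⟩

open Filter in
theorem Sim.exists_extension_ultrapower.{u} {E M : Type u} [Field E] [Field M]
    {A : ValuationSubring M} {t : M} {i j : E →+* M} (h : Sim A.valuation t i j)
    (hM : TModel A.valuation t) (hi : i.IsRelAlgClosed) {x : M} (hx : ∀ e, i e ≠ x) :
    ∃ (I : Type u) (u : Ultrafilter I) (D : Type u) (_ : Field D)
      (i' j' : D →+* Germ (u : Filter I) M) (e : E →+* D) (x' : D),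
      (∀ a, i' (e a) = (fun _ => i a : I → M)) ∧ (∀ a, j' (e a) = (fun _ => j a : I → M)) ∧
      i' x' = (fun _ => x : I → M) ∧
      Sim (A.ultrapower u).valuation ((fun _ => t : I → M) : Germ (u : Filter I) M) i' j' := by
  classical
  set v := A.valuation
  obtain ⟨τ, hτ, hτ'⟩ := h.unif
  choose e he₁ he₂ using fun k : Finset E[X] × ℕ =>
    hM.exists_approx hi hτ hx k.2.factorial_ne_zero k.1
  let u : Ultrafilter (Finset E[X] × ℕ) := Ultrafilter.of atTop
  have hu : ∀ k, ∀ᶠ l in (u : Filter (Finset E[X] × ℕ)), k ≤ l :=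
    fun k => Ultrafilter.of_le atTop (eventually_ge_atTop k)
  let f : E[X] →+* Germ (u : Filter (Finset E[X] × ℕ)) M :=
    (Germ.coeRingHom (u : Filter (Finset E[X] × ℕ))).comp (RingHom.pi fun _ => eval₂RingHom i x)
  let g : E[X] →+* Germ (u : Filter (Finset E[X] × ℕ)) M :=
    (Germ.coeRingHom (u : Filter (Finset E[X] × ℕ))).comp
      (RingHom.pi fun k => j.comp (evalRingHom (e k)))
  have hf : ∀ p, f p = (fun _ => eval₂ i x p : Finset E[X] × ℕ → M) := fun p => rfl
  have hg : ∀ p, g p = (fun k => j (p.eval (e k)) : Finset E[X] × ℕ → M) := fun p => rfl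
  have hinj : Function.Injective f := by
    rw [injective_iff_map_eq_zero]
    intro p hp
    by_contra hp0
    rw [hf] at hp
    obtain ⟨k, hk⟩ := (Germ.coe_eq.1 hp).exists
    obtain ⟨r, hr⟩ := hi x p hp0 hk
    exact hx r hr
  have hle : ∀ p q, (A.ultrapower u).valuation (f p) ≤ (A.ultrapower u).valuation (f q) ↔
      (A.ultrapower u).valuation (g p) ≤ (A.ultrapower u).valuation (g q) := by
    intro p q
    rw [hf, hf, hg, hg, A.valuation_ultrapower_le, A.valuation_ultrapower_le]
    refine eventually_congr ((hu ({p, q}, 0)).mono fun k hk => ?_)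
    rw [← h.le]
    exact he₁ k p (hk.1 (by simp)) q (hk.1 (by simp))
  have hpow : ∀ n : ℕ, n ≠ 0 → ∀ p, (∃ y, f p = y ^ n) ↔ ∃ y, g p = y ^ n := by
    intro n hn p
    rw [hf, hg, Germ.exists_eq_pow_iff, Germ.exists_eq_pow_iff]
    refine eventually_congr ((hu ({p}, n)).mono fun k hk => ?_)
    rw [← h.pow n hn]
    obtain ⟨c, hc, hc'⟩ := he₂ k p (hk.1 (by simp))
    exact hM.isPow_congr hc hn (Nat.dvd_factorial (Nat.pos_of_ne_zero hn) hk.2) hc'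
  have hτf : (A.ultrapower u).valuation (f (C τ)) = (A.ultrapower u).valuation
      ((fun _ => t : Finset E[X] × ℕ → M) : Germ (u : Filter (Finset E[X] × ℕ)) M) := by
    rw [hf, le_antisymm_iff, A.valuation_ultrapower_le, A.valuation_ultrapower_le]
    simp only [eval₂_C]
    exact ⟨Eventually.of_forall fun _ => hτ.le, Eventually.of_forall fun _ => hτ.ge⟩
  have hτg : (A.ultrapower u).valuation (g (C τ)) = (A.ultrapower u).valuation
      ((fun _ => t : Finset E[X] × ℕ → M) : Germ (u : Filter (Finset E[X] × ℕ)) M) := by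
    rw [hg, le_antisymm_iff, A.valuation_ultrapower_le, A.valuation_ultrapower_le]
    simp only [eval_C]
    exact ⟨Eventually.of_forall fun _ => hτ'.le, Eventually.of_forall fun _ => hτ'.ge⟩
  obtain ⟨i', j', hi', hj', hs⟩ := Sim.of_isDomain (v := (A.ultrapower u).valuation)
    (t := ((fun _ => t : Finset E[X] × ℕ → M) : Germ (u : Filter (Finset E[X] × ℕ)) M))
    hinj hle hpow ⟨C τ, hτf, hτg⟩
  refine ⟨_, u, FractionRing E[X], inferInstance, i', j', (algebraMap E[X] _).comp C,
    algebraMap E[X] _ X, fun a => ?_, fun a => ?_, ?_, hs⟩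
  · rw [RingHom.comp_apply, hi', hf]
    simp only [eval₂_C]
  · rw [RingHom.comp_apply, hj', hg]
    simp only [eval_C]
  · rw [hi', hf]
    simp only [eval₂_X]

section Parallel

variable (M N : Type*) [LVR.Structure M] [LVR.Structure N]

/-- Two functions on `M` and `N` are given by the same term. -/
def ParallelFun {α : Type*} (f : (α → M) → M) (g : (α → N) → N) : Prop :=
  ∃ s : LVR.Term α, (∀ x, s.realize x = f x) ∧ ∀ x, s.realize x = g x

/-- Two predicates on `M` and `N` are given by the same formula. -/
def ParallelPred {α : Type*} (P : (α → M) → Prop) (Q : (α → N) → Prop) : Prop :=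
  ∃ φ : LVR.Formula α, (∀ x, φ.Realize x ↔ P x) ∧ ∀ x, φ.Realize x ↔ Q x

variable {M N} {α β : Type*}

namespace ParallelPred

theorem iff {p q : Prop} (h : ParallelPred M N (fun _ : Empty → M => p) fun _ => q)
    (hMN : M ≅[LVR] N) : p ↔ q := by
  obtain ⟨φ, h1, h2⟩ := h
  refine (h1 Empty.elim).symm.trans (Iff.trans ?_ (h2 Empty.elim))
  have := (Language.elementarilyEquivalent_iff.1 hMN) φ
  rwa [Language.Sentence.Realize, Language.Sentence.Realize, Subsingleton.elim default Empty.elim,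
    Subsingleton.elim default Empty.elim] at this

theorem imp {P P' : (α → M) → Prop} {Q Q' : (α → N) → Prop} (h : ParallelPred M N P Q)
    (h' : ParallelPred M N P' Q') : ParallelPred M N (fun x => P x → P' x) fun x => Q x → Q' x := by
  obtain ⟨φ, h1, h2⟩ := h
  obtain ⟨ψ, h3, h4⟩ := h'
  exact ⟨φ.imp ψ, fun x => by rw [Language.Formula.realize_imp, h1, h3],
    fun x => by rw [Language.Formula.realize_imp, h2, h4]⟩

theorem and {P P' : (α → M) → Prop} {Q Q' : (α → N) → Prop} (h : ParallelPred M N P Q)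
    (h' : ParallelPred M N P' Q') : ParallelPred M N (fun x => P x ∧ P' x) fun x => Q x ∧ Q' x := by
  obtain ⟨φ, h1, h2⟩ := h
  obtain ⟨ψ, h3, h4⟩ := h'
  exact ⟨φ ⊓ ψ, fun x => by rw [Language.Formula.realize_inf, h1, h3],
    fun x => by rw [Language.Formula.realize_inf, h2, h4]⟩

theorem or {P P' : (α → M) → Prop} {Q Q' : (α → N) → Prop} (h : ParallelPred M N P Q)
    (h' : ParallelPred M N P' Q') : ParallelPred M N (fun x => P x ∨ P' x) fun x => Q x ∨ Q' x := by
  obtain ⟨φ, h1, h2⟩ := h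
  obtain ⟨ψ, h3, h4⟩ := h'
  exact ⟨φ ⊔ ψ, fun x => by rw [Language.Formula.realize_sup, h1, h3],
    fun x => by rw [Language.Formula.realize_sup, h2, h4]⟩

theorem not {P : (α → M) → Prop} {Q : (α → N) → Prop} (h : ParallelPred M N P Q) :
    ParallelPred M N (fun x => ¬ P x) fun x => ¬ Q x := by
  obtain ⟨φ, h1, h2⟩ := h
  exact ⟨φ.not, fun x => by rw [Language.Formula.realize_not, h1],
    fun x => by rw [Language.Formula.realize_not, h2]⟩

theorem iInf {κ : Type*} [Finite κ] {P : κ → (α → M) → Prop} {Q : κ → (α → N) → Prop}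
    (h : ∀ k, ParallelPred M N (P k) (Q k)) :
    ParallelPred M N (fun x => ∀ k, P k x) fun x => ∀ k, Q k x := by
  choose φ h1 h2 using h
  exact ⟨Language.Formula.iInf φ, fun x => by simp only [Language.Formula.realize_iInf, h1],
    fun x => by simp only [Language.Formula.realize_iInf, h2]⟩

theorem iSup {κ : Type*} [Finite κ] {P : κ → (α → M) → Prop} {Q : κ → (α → N) → Prop}
    (h : ∀ k, ParallelPred M N (P k) (Q k)) :
    ParallelPred M N (fun x => ∃ k, P k x) fun x => ∃ k, Q k x := by
  choose φ h1 h2 using h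
  exact ⟨Language.Formula.iSup φ, fun x => by simp only [Language.Formula.realize_iSup, h1],
    fun x => by simp only [Language.Formula.realize_iSup, h2]⟩

theorem forall_fun [Finite β] {P : (α → M) → (β → M) → Prop} {Q : (α → N) → (β → N) → Prop}
    (h : ParallelPred M N (fun z : α ⊕ β → M => P (fun a => z (.inl a)) fun b => z (.inr b))
      fun z => Q (fun a => z (.inl a)) fun b => z (.inr b)) :
    ParallelPred M N (fun x => ∀ y, P x y) fun x => ∀ y, Q x y := by
  obtain ⟨φ, h1, h2⟩ := h
  exact ⟨φ.iAlls β, fun x => by simp only [Language.Formula.realize_iAlls, h1]; rfl,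
    fun x => by simp only [Language.Formula.realize_iAlls, h2]; rfl⟩

theorem exists_fun [Finite β] {P : (α → M) → (β → M) → Prop} {Q : (α → N) → (β → N) → Prop}
    (h : ParallelPred M N (fun z : α ⊕ β → M => P (fun a => z (.inl a)) fun b => z (.inr b))
      fun z => Q (fun a => z (.inl a)) fun b => z (.inr b)) :
    ParallelPred M N (fun x => ∃ y, P x y) fun x => ∃ y, Q x y := by
  obtain ⟨φ, h1, h2⟩ := h
  exact ⟨φ.iExs β, fun x => by simp only [Language.Formula.realize_iExs, h1]; rfl,
    fun x => by simp only [Language.Formula.realize_iExs, h2]; rfl⟩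

theorem forall_elem {P : (α → M) → M → Prop} {Q : (α → N) → N → Prop}
    (h : ParallelPred M N (fun z : α ⊕ Unit → M => P (fun a => z (.inl a)) (z (.inr ())))
      fun z => Q (fun a => z (.inl a)) (z (.inr ()))) :
    ParallelPred M N (fun x => ∀ y, P x y) fun x => ∀ y, Q x y := by
  obtain ⟨φ, h1, h2⟩ := forall_fun (P := fun x y => P x (y ())) (Q := fun x y => Q x (y ())) h
  exact ⟨φ, fun x => (h1 x).trans ⟨fun h y => h fun _ => y, fun h y => h _⟩,
    fun x => (h2 x).trans ⟨fun h y => h fun _ => y, fun h y => h _⟩⟩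

theorem exists_elem {P : (α → M) → M → Prop} {Q : (α → N) → N → Prop}
    (h : ParallelPred M N (fun z : α ⊕ Unit → M => P (fun a => z (.inl a)) (z (.inr ())))
      fun z => Q (fun a => z (.inl a)) (z (.inr ()))) :
    ParallelPred M N (fun x => ∃ y, P x y) fun x => ∃ y, Q x y := by
  obtain ⟨φ, h1, h2⟩ := exists_fun (P := fun x y => P x (y ())) (Q := fun x y => Q x (y ())) h
  exact ⟨φ, fun x => (h1 x).trans ⟨fun ⟨y, h⟩ => ⟨_, h⟩, fun ⟨y, h⟩ => ⟨fun _ => y, h⟩⟩,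
    fun x => (h2 x).trans ⟨fun ⟨y, h⟩ => ⟨_, h⟩, fun ⟨y, h⟩ => ⟨fun _ => y, h⟩⟩⟩

theorem eq {f f' : (α → M) → M} {g g' : (α → N) → N} (h : ParallelFun M N f g)
    (h' : ParallelFun M N f' g') : ParallelPred M N (fun x => f x = f' x) fun x => g x = g' x := by
  obtain ⟨s, h1, h2⟩ := h
  obtain ⟨s', h3, h4⟩ := h'
  exact ⟨s.equal s', fun x => by rw [Language.Formula.realize_equal, h1, h3],
    fun x => by rw [Language.Formula.realize_equal, h2, h4]⟩

end ParallelPred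

theorem ParallelFun.var (a : α) : ParallelFun M N (fun x => x a) fun x => x a :=
  ⟨.var a, fun _ => rfl, fun _ => rfl⟩

namespace IsValuedStructure

variable [Field M] [Field N] {Γ Δ : Type*} [LinearOrderedCommGroupWithZero Γ]
  [LinearOrderedCommGroupWithZero Δ] {v : Valuation M Γ} {w : Valuation N Δ} {t : M} {s : N}

theorem parallelFun_zero (hM : IsValuedStructure v t) (hN : IsValuedStructure w s) :
    ParallelFun M N (fun _ : α → M => 0) fun _ => 0 :=
  ⟨.func LVR.zeroSymb Fin.elim0, fun _ => hM.zero _, fun _ => hN.zero _⟩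

theorem parallelFun_one (hM : IsValuedStructure v t) (hN : IsValuedStructure w s) :
    ParallelFun M N (fun _ : α → M => 1) fun _ => 1 :=
  ⟨.func LVR.oneSymb Fin.elim0, fun _ => hM.one _, fun _ => hN.one _⟩

variable {f f' : (α → M) → M} {g g' : (α → N) → N}

theorem parallelFun_add (hM : IsValuedStructure v t) (hN : IsValuedStructure w s)
    (h : ParallelFun M N f g) (h' : ParallelFun M N f' g') :
    ParallelFun M N (fun x => f x + f' x) fun x => g x + g' x := by
  obtain ⟨a, h1, h2⟩ := h
  obtain ⟨a', h3, h4⟩ := h'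
  exact ⟨.func LVR.addSymb ![a, a'],
    fun x => (hM.add _).trans (congrArg₂ _ (h1 x) (h3 x)),
    fun x => (hN.add _).trans (congrArg₂ _ (h2 x) (h4 x))⟩

theorem parallelFun_mul (hM : IsValuedStructure v t) (hN : IsValuedStructure w s)
    (h : ParallelFun M N f g) (h' : ParallelFun M N f' g') :
    ParallelFun M N (fun x => f x * f' x) fun x => g x * g' x := by
  obtain ⟨a, h1, h2⟩ := h
  obtain ⟨a', h3, h4⟩ := h'
  exact ⟨.func LVR.mulSymb ![a, a'],
    fun x => (hM.mul _).trans (congrArg₂ _ (h1 x) (h3 x)),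
    fun x => (hN.mul _).trans (congrArg₂ _ (h2 x) (h4 x))⟩

theorem parallelFun_pow (hM : IsValuedStructure v t) (hN : IsValuedStructure w s)
    (h : ParallelFun M N f g) (n : ℕ) :
    ParallelFun M N (fun x => f x ^ n) fun x => g x ^ n := by
  induction n with
  | zero => simpa only [pow_zero] using hM.parallelFun_one hN
  | succ n ih => simpa only [pow_succ] using hM.parallelFun_mul hN ih h

theorem parallelFun_natCast (hM : IsValuedStructure v t) (hN : IsValuedStructure w s) (n : ℕ) :
    ParallelFun M N (fun _ : α → M => (n : M)) fun _ => (n : N) := by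
  induction n with
  | zero => simpa only [Nat.cast_zero] using hM.parallelFun_zero hN
  | succ n ih => simpa only [Nat.cast_succ] using hM.parallelFun_add hN ih (hM.parallelFun_one hN)

theorem parallelFun_sum (hM : IsValuedStructure v t) (hN : IsValuedStructure w s) {κ : Type*}
    {f : κ → (α → M) → M} {g : κ → (α → N) → N} (S : Finset κ)
    (h : ∀ k, ParallelFun M N (f k) (g k)) :
    ParallelFun M N (fun x => ∑ k ∈ S, f k x) fun x => ∑ k ∈ S, g k x := by
  classical
  induction S using Finset.induction_on with
  | empty => simpa only [Finset.sum_empty] using hM.parallelFun_zero hN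
  | insert k S hk ih =>
    simpa only [Finset.sum_insert hk] using hM.parallelFun_add hN (h k) ih

/-- The monic polynomial function with coefficients given by `a`. -/
theorem parallelFun_monic (hM : IsValuedStructure v t) (hN : IsValuedStructure w s) {d : ℕ}
    {a : Fin d → (α → M) → M} {b : Fin d → (α → N) → N} (hab : ∀ i, ParallelFun M N (a i) (b i))
    (h : ParallelFun M N f g) :
    ParallelFun M N (fun x => f x ^ d + ∑ i, a i x * f x ^ (i : ℕ))
      fun x => g x ^ d + ∑ i, b i x * g x ^ (i : ℕ) :=
  hM.parallelFun_add hN (hM.parallelFun_pow hN h d) <| hM.parallelFun_sum hN _ fun i =>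
    hM.parallelFun_mul hN (hab i) (hM.parallelFun_pow hN h i)

theorem parallelPred_le (hM : IsValuedStructure v t) (hN : IsValuedStructure w s)
    (h : ParallelFun M N f g) (h' : ParallelFun M N f' g') :
    ParallelPred M N (fun x => v (f x) ≤ v (f' x)) fun x => w (g x) ≤ w (g' x) := by
  obtain ⟨a, h1, h2⟩ := h
  obtain ⟨a', h3, h4⟩ := h'
  refine ⟨Language.Relations.formula₂ LVR.dvdSymb a' a, fun x => ?_, fun x => ?_⟩
  · dsimp only
    rw [Language.Formula.realize_rel₂, hM.dvd, ← h1, ← h3]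
    rfl
  · dsimp only
    rw [Language.Formula.realize_rel₂, hN.dvd, ← h2, ← h4]
    rfl

theorem parallelPred_lt (hM : IsValuedStructure v t) (hN : IsValuedStructure w s)
    (h : ParallelFun M N f g) (h' : ParallelFun M N f' g') :
    ParallelPred M N (fun x => v (f x) < v (f' x)) fun x => w (g x) < w (g' x) := by
  simpa only [not_le] using (hM.parallelPred_le hN h' h).not

theorem parallelPred_eq (hM : IsValuedStructure v t) (hN : IsValuedStructure w s)
    (h : ParallelFun M N f g) (h' : ParallelFun M N f' g') :
    ParallelPred M N (fun x => v (f x) = v (f' x)) fun x => w (g x) = w (g' x) := by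
  simpa only [le_antisymm_iff] using (hM.parallelPred_le hN h h').and (hM.parallelPred_le hN h' h)

theorem parallelPred_unif (hM : IsValuedStructure v t) (hN : IsValuedStructure w s)
    (h : ParallelFun M N f g) :
    ParallelPred M N (fun x => v (f x) = v t) fun x => w (g x) = w s := by
  obtain ⟨a, h1, h2⟩ := h
  refine ⟨Language.Relations.formula₁ LVR.unifSymb a, fun x => ?_, fun x => ?_⟩
  · dsimp only
    rw [Language.Formula.realize_rel₁, hM.N, ← h1]
    rfl
  · dsimp only
    rw [Language.Formula.realize_rel₁, hN.N, ← h2]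
    rfl

end IsValuedStructure

end Parallel

theorem Polynomial.Monic.eval_eq_add_sum {R : Type*} [CommRing R] {p : R[X]} (hp : p.Monic)
    {d : ℕ} (hd : p.natDegree = d) (x : R) :
    p.eval x = x ^ d + ∑ i : Fin d, p.coeff i * x ^ (i : ℕ) := by
  subst hd
  rw [eval_eq_sum_range, Finset.sum_range_succ, hp.coeff_natDegree, one_mul, add_comm,
    Fin.sum_univ_eq_sum_range fun i => p.coeff i * x ^ i]

section MonicPolynomial

variable {R : Type*} [CommRing R] {d : ℕ} (a : Fin d → R)

theorem Polynomial.degree_sum_C_mul_X_pow_lt :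
    (∑ i : Fin d, C (a i) * X ^ (i : ℕ)).degree < (d : WithBot ℕ) :=
  (degree_sum_le _ _).trans_lt <| (Finset.sup_lt_iff (WithBot.bot_lt_coe d)).2 fun i _ =>
    (degree_C_mul_X_pow_le _ _).trans_lt (WithBot.coe_lt_coe.2 i.2)

theorem Polynomial.monic_X_pow_add_sum : (X ^ d + ∑ i : Fin d, C (a i) * X ^ (i : ℕ)).Monic :=
  monic_X_pow_add (degree_sum_C_mul_X_pow_lt a)

theorem Polynomial.natDegree_X_pow_add_sum [Nontrivial R] :
    (X ^ d + ∑ i : Fin d, C (a i) * X ^ (i : ℕ)).natDegree = d := by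
  refine natDegree_eq_of_degree_eq_some ?_
  rw [degree_add_eq_left_of_degree_lt (by rw [degree_X_pow]; exact degree_sum_C_mul_X_pow_lt a),
    degree_X_pow]

theorem Polynomial.eval_X_pow_add_sum (x : R) :
    (X ^ d + ∑ i : Fin d, C (a i) * X ^ (i : ℕ)).eval x =
      x ^ d + ∑ i : Fin d, a i * x ^ (i : ℕ) := by
  simp [eval_finsetSum]

theorem Polynomial.coeff_X_pow_add_sum (k : Fin d) :
    (X ^ d + ∑ i : Fin d, C (a i) * X ^ (i : ℕ)).coeff k = a k := by
  simp only [coeff_add, coeff_X_pow, finsetSum_coeff, coeff_C_mul, k.2.ne, if_false, zero_add,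
    Fin.val_inj, mul_ite, mul_one, mul_zero, Finset.sum_ite_eq, Finset.mem_univ, if_true]

end MonicPolynomial

section Transfer

variable {M Γ : Type*} [Field M] [LinearOrderedCommGroupWithZero Γ] {v : Valuation M Γ} {t : M}

theorem Valuation.forall_irreducible_iff [Infinite M] (v : Valuation M Γ) :
    (∀ p : M[X], p.Monic → Irreducible p → ∀ i ≤ p.natDegree,
      v (p.coeff i) ^ p.natDegree ≤ v (p.coeff 0) ^ (p.natDegree - i)) ↔
    ∀ (d : ℕ) (a : Fin (d + 1) → M),
      (∀ i : Fin (d + 1), v (a i ^ (d + 1)) ≤ v (a 0 ^ (d + 1 - (i : ℕ)))) ∨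
      ∃ k : Fin d, ∃ (b : Fin (k + 1) → M) (c : Fin (d - k) → M), ∀ x,
        x ^ (d + 1) + ∑ i, a i * x ^ (i : ℕ) =
        (x ^ ((k : ℕ) + 1) + ∑ i, b i * x ^ (i : ℕ)) *
          (x ^ (d - (k : ℕ)) + ∑ i, c i * x ^ (i : ℕ)) := by
  constructor
  · intro h d a
    have hm := monic_X_pow_add_sum a
    have hd := natDegree_X_pow_add_sum a
    by_cases hirr : Irreducible (X ^ (d + 1) + ∑ i : Fin (d + 1), C (a i) * X ^ (i : ℕ))
    · left
      intro i
      have := h _ hm hirr i (hd.symm ▸ i.2.le)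
      rw [hd, coeff_X_pow_add_sum] at this
      have h0 := coeff_X_pow_add_sum a 0
      rw [Fin.val_zero] at h0
      rwa [h0, ← map_pow, ← map_pow] at this
    · right
      rw [hm.irreducible_iff_natDegree', not_and] at hirr
      specialize hirr fun h1 => by simp [h1] at hd
      push Not at hirr
      obtain ⟨f, g, hf, hg, hfg, hmem⟩ := hirr
      rw [Finset.mem_Ioc, hd] at hmem
      have hsum : f.natDegree + g.natDegree = d + 1 := by
        rw [← hf.natDegree_mul hg, hfg, hd]
      refine ⟨⟨f.natDegree - 1, by omega⟩, fun i => f.coeff i, fun i => g.coeff i, fun x => ?_⟩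
      rw [← eval_X_pow_add_sum a, ← hfg, eval_mul]
      exact congrArg₂ _ (hf.eval_eq_add_sum (by dsimp only; omega) x)
        (hg.eval_eq_add_sum (by dsimp only; omega) x)
  · intro h p hp hirr i hi
    rcases hi.eq_or_lt with rfl | hi
    · rw [hp.coeff_natDegree, map_one, one_pow, Nat.sub_self, pow_zero]
    obtain ⟨d, hd⟩ : ∃ d, p.natDegree = d + 1 := ⟨p.natDegree - 1, by omega⟩
    rw [hd] at hi ⊢
    rcases h d (fun i => p.coeff i) with h | ⟨k, b, c, h⟩
    · simpa only [map_pow, Fin.val_zero] using h ⟨i, hi⟩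
    · exfalso
      have hpq : p = (X ^ ((k : ℕ) + 1) + ∑ i : Fin (k + 1), C (b i) * X ^ (i : ℕ)) *
          (X ^ (d - (k : ℕ)) + ∑ i : Fin (d - k), C (c i) * X ^ (i : ℕ)) := by
        refine Polynomial.funext fun x => ?_
        rw [eval_mul, eval_X_pow_add_sum, eval_X_pow_add_sum, ← h, hp.eval_eq_add_sum hd]
      rcases hirr.isUnit_or_isUnit hpq with hu | hu
      · have := natDegree_eq_zero_of_isUnit hu
        rw [natDegree_X_pow_add_sum] at this
        omega
      · have := natDegree_eq_zero_of_isUnit hu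
        rw [natDegree_X_pow_add_sum] at this
        omega

/-- Being a `TModel` is a first-order property. -/
theorem TModel.of_elementarilyEquivalent {N Δ : Type*} [Field N]
    [LinearOrderedCommGroupWithZero Δ] {w : Valuation N Δ} {s : N} [LVR.Structure M]
    [LVR.Structure N] (hM : IsValuedStructure v t) (hN : IsValuedStructure w s)
    (hMN : M ≅[LVR] N) (h : TModel w s) : TModel v t := by
  have hunif : ∀ τ, v τ = v t → τ ≠ 0 ∧ v τ < v 1 ∧ ∀ x, v x < v 1 → v x ≤ v τ := by
    refine (ParallelPred.iff (M := M) (N := N) (q := ∀ τ, w τ = w s → τ ≠ 0 ∧ w τ < w 1 ∧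
      ∀ x, w x < w 1 → w x ≤ w τ) ?_ hMN).2 fun τ hτ => ?_
    · exact .forall_elem <| (hM.parallelPred_unif hN (.var _)).imp <|
        (ParallelPred.eq (.var _) (hM.parallelFun_zero hN)).not.and <|
        (hM.parallelPred_lt hN (.var _) (hM.parallelFun_one hN)).and <| .forall_elem <|
        (hM.parallelPred_lt hN (.var _) (hM.parallelFun_one hN)).imp <|
        hM.parallelPred_le hN (.var _) (.var _)
    · simp only [map_one, hτ]
      exact ⟨fun h0 => h.ne_zero <| by
        rwa [h0, map_zero, eq_comm, map_eq_zero] at hτ, h.lt_one, h.le_of_lt_one⟩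
  obtain ⟨h0, h1, h2⟩ := hunif t rfl
  rw [map_one] at h1
  simp only [map_one] at h2
  have hcast : ∀ n : ℕ, n ≠ 0 → v (n : M) = 1 := fun n hn => by
    refine (map_one v) ▸ (ParallelPred.iff (M := M) (N := N) (q := w (n : N) = w 1) ?_ hMN).2 ?_
    · exact hM.parallelPred_eq hN (hM.parallelFun_natCast hN n) (hM.parallelFun_one hN)
    · rw [map_one, h.natCast n hn]
  refine ⟨h0, h1, h2, hcast, fun n hn x hx => ?_, fun d hd => ?_, ?_⟩
  · have : ∀ τ, v τ = v t → ∀ x, x ≠ 0 → ∃ i : Fin n, ∃ y, v x = v (τ ^ (i : ℕ) * y ^ n) := by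
      refine (ParallelPred.iff (M := M) (N := N) (q := ∀ τ, w τ = w s → ∀ x, x ≠ 0 →
        ∃ i : Fin n, ∃ y, w x = w (τ ^ (i : ℕ) * y ^ n)) ?_ hMN).2 fun τ hτ x hx => ?_
      · exact .forall_elem <| (hM.parallelPred_unif hN (.var _)).imp <| .forall_elem <|
          (ParallelPred.eq (.var _) (hM.parallelFun_zero hN)).not.imp <| .iSup fun i =>
          .exists_elem <| hM.parallelPred_eq hN (.var _) <|
          hM.parallelFun_mul hN (hM.parallelFun_pow hN (.var _) _)
            (hM.parallelFun_pow hN (.var _) _)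
      · obtain ⟨i, hi, y, hy⟩ := h.div n hn x hx
        exact ⟨⟨i, hi⟩, y, by simpa only [map_mul, map_pow, hτ] using hy⟩
    obtain ⟨i, y, hy⟩ := this t rfl x hx
    exact ⟨i, i.2, y, hy⟩
  · have : ∀ a : Fin d → M, (∀ i, v (a i) ≤ v 1) →
        ∃ m, v m ≤ v 1 ∧ v (m ^ d + ∑ i, a i * m ^ (i : ℕ)) < v 1 := by
      refine (ParallelPred.iff (M := M) (N := N) (q := ∀ a : Fin d → N, (∀ i, w (a i) ≤ w 1) →
        ∃ m, w m ≤ w 1 ∧ w (m ^ d + ∑ i, a i * m ^ (i : ℕ)) < w 1) ?_ hMN).2 ?_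
      · exact .forall_fun <| (ParallelPred.iInf fun i =>
          hM.parallelPred_le hN (.var _) (hM.parallelFun_one hN)).imp <| .exists_elem <|
          (hM.parallelPred_le hN (.var _) (hM.parallelFun_one hN)).and <|
          hM.parallelPred_lt hN (hM.parallelFun_monic hN (fun i => .var _) (.var _))
            (hM.parallelFun_one hN)
      · simpa only [map_one] using h.res d hd
    simpa only [map_one] using this
  · have : CharZero M := charZero_of_inj_zero fun n hn => by
      by_contra hn'
      have := hcast n hn'
      rw [hn, map_zero] at this
      exact zero_ne_one this
    have := h.charZero
    refine v.forall_irreducible_iff.2 fun d => (ParallelPred.iff (M := M) (N := N) ?_ hMN).2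
      (w.forall_irreducible_iff.1 h.hensel d)
    exact .forall_fun <| (ParallelPred.iInf fun i => hM.parallelPred_le hN
        (hM.parallelFun_pow hN (.var _) _) (hM.parallelFun_pow hN (.var _) _)).or <|
      .iSup fun k => .exists_fun <| .exists_fun <| .forall_elem <|
      .eq (hM.parallelFun_monic hN (fun i => .var _) (.var _)) <|
      hM.parallelFun_mul hN (hM.parallelFun_monic hN (fun i => .var _) (.var _))
        (hM.parallelFun_monic hN (fun i => .var _) (.var _))

end Transfer

section Complete

open scoped Valued

theorem Valued.map_coeff_pow_le_of_irreducible {K Γ : Type*} [Field K]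
    [LinearOrderedCommGroupWithZero Γ] [hv : Valued K Γ] [hv.v.RankOne] [CompleteSpace K]
    {p : K[X]} (hp : p.Monic) (hirr : Irreducible p) {i : ℕ} (hi : i ≤ p.natDegree) :
    hv.v (p.coeff i) ^ p.natDegree ≤ hv.v (p.coeff 0) ^ (p.natDegree - i) := by
  rw [← map_pow, ← map_pow, ← Valued.toNormedField.norm_le_iff, norm_pow, norm_pow]
  rcases hi.eq_or_lt with rfl | hi
  · rw [hp.coeff_natDegree, norm_one, one_pow, Nat.sub_self, pow_zero]
  obtain ⟨x, hx⟩ := IsAlgClosed.exists_aeval_eq_zero (AlgebraicClosure K) p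
    (degree_pos_of_irreducible hirr).ne'
  have hmin := minpoly.eq_of_irreducible_of_monic hirr hx hp
  have h1 := spectralNorm.spectralNorm_eq_norm_coeff_zero_rpow K (AlgebraicClosure K) x
  have h2 := le_ciSup (spectralValueTerms_bddAbove (minpoly K x)) i
  change _ ≤ spectralNorm K _ x at h2
  rw [h1, ← hmin, spectralValueTerms_of_lt_natDegree _ hi] at h2
  rw [← Nat.cast_sub hi.le, one_div, one_div] at h2
  have h3 := pow_le_pow_left₀ (by positivity) h2 ((p.natDegree - i) * p.natDegree)
  rwa [pow_mul, mul_comm (p.natDegree - i), pow_mul,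
    Real.rpow_inv_natCast_pow (norm_nonneg _) (Nat.sub_pos_of_lt hi).ne',
    Real.rpow_inv_natCast_pow (norm_nonneg _) (Nat.zero_lt_of_lt hi).ne'] at h3

end Complete

namespace LaurentSeries

open WithZero

theorem v_le_one_iff (x : LaurentSeries ℂ) :
    (Valued.v x : ℤᵐ⁰) ≤ 1 ↔ ∀ n < 0, x.coeff n = 0 := by
  have := valuation_le_iff_coeff_lt_eq_zero ℂ (D := 0) (f := x)
  rwa [neg_zero, exp_zero] at this

theorem v_lt_one_iff (x : LaurentSeries ℂ) :
    (Valued.v x : ℤᵐ⁰) < 1 ↔ Valued.v x ≤ exp (-1 : ℤ) := by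
  constructor
  · intro h
    rcases eq_or_ne (Valued.v x : ℤᵐ⁰) 0 with h0 | h0
    · exact h0 ▸ zero_le
    · rw [← exp_log h0, ← exp_zero, exp_lt_exp] at h
      rw [← exp_log h0, exp_le_exp]
      omega
  · exact fun h => h.trans_lt (by rw [← exp_zero, exp_lt_exp]; omega)

theorem v_single (n : ℤ) :
    (Valued.v (HahnSeries.single n 1 : LaurentSeries ℂ) : ℤᵐ⁰) = exp (-n) :=
  valuation_single_zpow ℂ n

theorem v_C_of_ne_zero {c : ℂ} (hc : c ≠ 0) :
    (Valued.v (HahnSeries.C c : LaurentSeries ℂ) : ℤᵐ⁰) = 1 := by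
  have h : ∀ c : ℂ, (Valued.v (HahnSeries.C c : LaurentSeries ℂ) : ℤᵐ⁰) ≤ 1 := fun c => by
    rw [v_le_one_iff]
    intro n hn
    rw [HahnSeries.C_apply, HahnSeries.coeff_single_of_ne hn.ne]
  refine le_antisymm (h c) ?_
  have := h c⁻¹
  rwa [map_inv₀ HahnSeries.C, map_inv₀, inv_le_one₀] at this
  simpa [zero_lt_iff] using hc

theorem v_C_le_one (c : ℂ) : (Valued.v (HahnSeries.C c : LaurentSeries ℂ) : ℤᵐ⁰) ≤ 1 := by
  rcases eq_or_ne c 0 with rfl | hc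
  · simp
  · exact (v_C_of_ne_zero hc).le

theorem v_sub_C_lt_one {x : LaurentSeries ℂ} (hx : (Valued.v x : ℤᵐ⁰) ≤ 1) :
    (Valued.v (x - HahnSeries.C (x.coeff 0)) : ℤᵐ⁰) < 1 := by
  rw [v_lt_one_iff, valuation_le_iff_coeff_lt_eq_zero]
  intro n hn
  rw [v_le_one_iff] at hx
  rw [HahnSeries.coeff_sub, HahnSeries.C_apply]
  rcases eq_or_ne n 0 with rfl | h0
  · rw [HahnSeries.coeff_single_same, sub_self]
  · rw [HahnSeries.coeff_single_of_ne h0, sub_zero]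
    exact hx n (by omega)

theorem tModel : TModel (Valued.v : Valuation (LaurentSeries ℂ) ℤᵐ⁰) (HahnSeries.single 1 1) := by
  have hlt : (Valued.v (HahnSeries.single 1 1 : LaurentSeries ℂ) : ℤᵐ⁰) < 1 := by
    rw [v_lt_one_iff, v_single]
  refine ⟨by simp, hlt, fun x hx => ?_, fun n hn => ?_, fun n hn x hx => ?_,
    fun d hd a ha => ?_, fun p hp hirr i hi => ?_⟩
  · rwa [v_single, ← v_lt_one_iff]
  · rw [← map_natCast HahnSeries.C, v_C_of_ne_zero (Nat.cast_ne_zero.2 hn)]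
  · have h0 : (Valued.v x : ℤᵐ⁰) ≠ 0 := (Valuation.ne_zero_iff _).2 hx
    set m := log (Valued.v x : ℤᵐ⁰) with hm
    have hn' : (n : ℤ) ≠ 0 := by exact_mod_cast hn
    have h1 := Int.emod_nonneg (-m) hn'
    have h2 := Int.emod_lt_of_pos (-m) (b := n) (by omega)
    refine ⟨((-m) % n).toNat, by omega, HahnSeries.single ((-m) / n) 1, ?_⟩
    rw [map_mul, map_pow, map_pow, v_single, v_single, ← exp_nsmul, ← exp_nsmul, ← exp_add,
      ← exp_log h0, ← hm]
    congr 1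
    have := Int.emod_add_mul_ediv (-m) n
    rw [nsmul_eq_mul, nsmul_eq_mul, Int.toNat_of_nonneg h1]
    linarith
  · obtain ⟨μ, hμ⟩ := IsAlgClosed.exists_root
      (X ^ d + ∑ i : Fin d, Polynomial.C ((a i).coeff 0) * X ^ (i : ℕ)) (by
        rw [degree_eq_natDegree (monic_X_pow_add_sum _).ne_zero, natDegree_X_pow_add_sum]
        exact_mod_cast hd)
    rw [IsRoot, eval_X_pow_add_sum] at hμ
    refine ⟨HahnSeries.C μ, v_C_le_one μ, ?_⟩
    have : HahnSeries.C μ ^ d + ∑ i, a i * HahnSeries.C μ ^ (i : ℕ) =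
        ∑ i, (a i - HahnSeries.C ((a i).coeff 0)) * HahnSeries.C μ ^ (i : ℕ) := by
      have := congrArg (HahnSeries.C (Γ := ℤ)) hμ
      rw [map_add, map_pow, map_sum, map_zero] at this
      simp only [map_mul, map_pow] at this
      simp only [sub_mul, Finset.sum_sub_distrib]
      linear_combination this
    rw [this]
    refine Valuation.map_sum_lt _ one_ne_zero fun i _ => ?_
    rw [map_mul, map_pow]
    exact mul_lt_one_of_lt_of_le (v_sub_C_lt_one (ha i)) (pow_le_one₀ zero_le (v_C_le_one μ))
  · have : (Valued.v : Valuation (LaurentSeries ℂ) ℤᵐ⁰).IsNontrivial :=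
      ⟨_, ((Valuation.ne_zero_iff _).2 (by simp)), hlt.ne⟩
    obtain ⟨_⟩ := (Valuation.nonempty_rankOne_iff_mulArchimedean
      (v := (Valued.v : Valuation (LaurentSeries ℂ) ℤᵐ⁰))).2
      (MulArchimedean.comap MonoidWithZeroHom.ValueGroup₀.embedding.toMonoidHom
        MonoidWithZeroHom.ValueGroup₀.embedding_strictMono)
    exact Valued.map_coeff_pow_le_of_irreducible hp hirr hi

end LaurentSeries

namespace IsValuedStructure

open FirstOrder.Language

theorem exists_realize_term {D M Γ β : Type*} [Field D] [Field M] [LVR.Structure M]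
    [LinearOrderedCommGroupWithZero Γ] {v : Valuation M Γ} {t : M} (h : IsValuedStructure v t)
    (T : LVR.Term β) (x : β → D) : ∃ d, ∀ i : D →+* M, T.realize (fun b => i (x b)) = i d := by
  induction T with
  | var b => exact ⟨x b, fun i => rfl⟩
  | @func n f ts ih =>
    choose d hd using ih
    match n, f with
    | _, LVRFunc.zero => exact ⟨0, fun i => (h.zero _).trans (map_zero i).symm⟩
    | _, LVRFunc.one => exact ⟨1, fun i => (h.one _).trans (map_one i).symm⟩
    | _, LVRFunc.add =>
      exact ⟨d 0 + d 1, fun i => (h.add _).trans (by rw [hd, hd, map_add])⟩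
    | _, LVRFunc.mul =>
      exact ⟨d 0 * d 1, fun i => (h.mul _).trans (by rw [hd, hd, map_mul])⟩

theorem tModel_ultrapower {M I : Type*} [Field M] [LVR.Structure M] {A : ValuationSubring M}
    {t : M} (h : IsValuedStructure A.valuation t) (hM : TModel A.valuation t)
    (u : Ultrafilter I) :
    TModel (A.ultrapower u).valuation ((fun _ => t : I → M) : Filter.Germ (u : Filter I) M) :=
  TModel.of_elementarilyEquivalent (h.ultrapower u) h
    (Filter.Germ.elementarilyEquivalent u).symm hM

theorem sumElim_comp {D M α β : Type*} (i : D → M) (x : α → D) (y : β → D) :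
    Sum.elim (fun b => i (x b)) (fun k => i (y k)) = fun b => i (Sum.elim x y b) := by
  funext b
  cases b <;> rfl

theorem snoc_comp {D M : Type*} {n : ℕ} (i : D → M) (y : Fin n → D) (d : D) :
    (Fin.snoc (fun k => i (y k)) (i d) : Fin (n + 1) → M) =
      fun k => i ((Fin.snoc y d : Fin (n + 1) → D) k) :=
  (Fin.comp_snoc i y d).symm

theorem relMap_of_sim {D M Γ : Type*} [Field D] [Field M] [LVR.Structure M]
    [LinearOrderedCommGroupWithZero Γ] {v : Valuation M Γ} {t : M} (h : IsValuedStructure v t)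
    {i j : D →+* M} (hs : Sim v t i j) {n : ℕ} (R : LVR.Relations n) (d : Fin n → D)
    (hR : Structure.RelMap R fun k => i (d k)) : Structure.RelMap R fun k => j (d k) := by
  match n, R with
  | _, LVRRel.dvd =>
    refine (h.dvd _).2 ?_
    exact (hs.le _ _).1 ((h.dvd _).1 hR)
  | _, LVRRel.N =>
    refine (h.N _).2 ?_
    obtain ⟨τ, h1, h2⟩ := hs.unif
    have := (h.N _).1 hR
    rw [← h1] at this
    rw [← h2]
    exact le_antisymm ((hs.le _ _).1 this.le) ((hs.le _ _).1 this.ge)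
  | _, LVRRel.pow m =>
    refine (h.pow m _).2 ?_
    exact (hs.pow m m.ne_zero _).1 ((h.pow m _).1 hR)

/-- Two embeddings inducing the same valuation and the same powers satisfy the same formulas. -/
theorem realize_of_sim.{u} {α : Type*} {n : ℕ} (φ : LVR.BoundedFormula α n) :
    ∀ {D M : Type u} [Field D] [Field M] [LVR.Structure M] {A : ValuationSubring M} {t : M}
      (_ : IsValuedStructure A.valuation t) (_ : TModel A.valuation t) {i j : D →+* M}
      (_ : Sim A.valuation t i j) (x : α → D) (y : Fin n → D),
      (φ.Realize (fun b => i (x b)) fun k => i (y k)) →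
      φ.Realize (fun b => j (x b)) fun k => j (y k) := by
  induction φ with
  | falsum => exact fun _ _ _ _ _ _ _ h => h
  | equal t₁ t₂ =>
    intro D M _ _ _ A t h hM i j hs x y hφ
    obtain ⟨d₁, h₁⟩ := h.exists_realize_term t₁ (Sum.elim x y)
    obtain ⟨d₂, h₂⟩ := h.exists_realize_term t₂ (Sum.elim x y)
    change Term.realize _ _ = Term.realize _ _ at hφ ⊢
    rw [sumElim_comp, h₁, h₂] at hφ ⊢
    rw [i.injective hφ]
  | rel R ts =>
    intro D M _ _ _ A t h hM i j hs x y hφ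
    choose d hd using fun k => h.exists_realize_term (ts k) (Sum.elim x y)
    change Structure.RelMap R (fun k => Term.realize _ _) at hφ
    change Structure.RelMap R (fun k => Term.realize _ _)
    rw [sumElim_comp] at hφ ⊢
    simp only [hd] at hφ ⊢
    exact h.relMap_of_sim hs R d hφ
  | imp φ ψ ihφ ihψ =>
    intro D M _ _ _ A t h hM i j hs x y hφ hx
    exact ihψ h hM hs x y (hφ (ihφ h hM hs.symm x y hx))
  | @all n φ ih =>
    intro D M _ _ _ A t h hM i j hs x y hφ z
    obtain ⟨R, _, e, i', j', rfl, rfl, hs', hR⟩ := hs.symm.exists_relAlgClosed hM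
    by_cases hz : ∃ r, i' r = z
    · obtain ⟨r, rfl⟩ := hz
      have h1 := hφ (j' r)
      simp only [RingHom.comp_apply] at h1 ⊢
      rw [snoc_comp j' (fun k => e (y k))] at h1
      rw [snoc_comp i' (fun k => e (y k))]
      exact ih h hM hs'.symm (fun b => e (x b)) _ h1
    · push Not at hz
      obtain ⟨I, u, E, _, i'', j'', f, x', hi, hj, hx, hs''⟩ :=
        hs'.exists_extension_ultrapower hM hR hz
      have h1 := (Filter.Germ.realize_coe u φ.all (fun b _ => j' (e (x b)))
        fun k _ => j' (e (y k))).2 (Filter.Eventually.of_forall fun _ => hφ) (j'' x')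
      simp only [← hj] at h1
      rw [snoc_comp j'' (fun k => f (e (y k)))] at h1
      have h2 := ih (h.ultrapower u) (h.tModel_ultrapower hM u) hs''.symm (fun b => f (e (x b))) _ h1
      rw [← snoc_comp i'' (fun k => f (e (y k)))] at h2
      simp only [hi, hx] at h2
      rw [snoc_comp (fun z : M => ((fun _ => z : I → M) : Filter.Germ (u : Filter I) M))
        (fun k => i' (e (y k)))] at h2
      exact Filter.eventually_const.1 ((Filter.Germ.realize_coe u φ _ _).1 h2)

end IsValuedStructure

section Gauss

variable {F : Type*} [Field F] (A : ValuationSubring F) (K : Subfield F)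

/-- The residue of `a` is transcendental over the residue field of the subfield `K`. -/
def ValuationSubring.IsResidueTranscendental (a : A) : Prop :=
  ∀ p : (IsLocalRing.ResidueField A)[X], p ≠ 0 →
    (∀ i, ∃ c : A, (c : F) ∈ K ∧ IsLocalRing.residue A c = p.coeff i) →
    p.eval (IsLocalRing.residue A a) ≠ 0

/-- The Gauss valuation of a polynomial computes its values at elements with transcendental
residue. -/
theorem ValuationSubring.exists_valuation_eval_eq {p : K[X]} (hp : p ≠ 0) :
    ∃ c : F, c ≠ 0 ∧ ∀ a : A, A.IsResidueTranscendental K a →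
      A.valuation (p.eval₂ K.subtype (a : F)) = A.valuation c := by
  obtain ⟨i, hi, hmax⟩ := p.support.exists_max_image
    (fun i => A.valuation (p.coeff i : F)) (support_nonempty.2 hp)
  have hc : (p.coeff i : F) ≠ 0 := by
    simpa using hi
  have hmax' : ∀ k, A.valuation (p.coeff k : F) ≤ A.valuation (p.coeff i : F) := fun k => by
    by_cases hk : k ∈ p.support
    · exact hmax k hk
    · rw [notMem_support_iff.1 hk]
      simp
  refine ⟨p.coeff i, hc, fun a ha => ?_⟩
  obtain ⟨q, hq⟩ := (lifts_iff_coeff_lifts (f := algebraMap A F)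
    (C (p.coeff i : F)⁻¹ * p.map K.subtype)).2 fun k => by
      refine ⟨⟨(p.coeff i : F)⁻¹ * p.coeff k, ?_⟩, by simp⟩
      rw [← A.valuation_le_one_iff, map_mul, map_inv₀, inv_mul_le_one₀]
      · exact hmax' k
      · simpa [zero_lt_iff] using hc
  have hq' : ∀ k, (q.coeff k : F) = (p.coeff i : F)⁻¹ * p.coeff k := fun k => by
    have := congrArg (fun r => r.coeff k) hq
    simpa using this
  have h1 := ha (q.map (IsLocalRing.residue A)) (fun h0 => by
      have h1 : q.coeff i = 1 := Subtype.ext ((hq' i).trans (inv_mul_cancel₀ hc))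
      have := congrArg (fun r => r.coeff i) h0
      simp [h1] at this)
    fun k => ⟨q.coeff k, by
      rw [hq']
      exact K.mul_mem (K.inv_mem (p.coeff i).2) (p.coeff k).2, (coeff_map _ _).symm⟩
  rw [eval_map, eval₂_at_apply, IsLocalRing.residue_ne_zero_iff_isUnit,
    A.valuation_eq_one_iff] at h1
  have h2 : ((q.eval a : A) : F) = (p.coeff i : F)⁻¹ * p.eval₂ K.subtype (a : F) := by
    have := congrArg (fun r => r.eval (a : F)) hq
    simp only [coe_mapRingHom, eval_map, eval_mul, eval_C] at this
    rw [← this]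
    exact (eval₂_at_apply (algebraMap A F) a).symm
  rw [h2, map_mul, map_inv₀, inv_mul_eq_one₀ (by simpa using hc)] at h1
  exact h1.symm

/-- Evaluation at two elements with transcendental residue. -/
theorem ValuationSubring.exists_sim_of_isResidueTranscendental {t : F} (h : TModel A.valuation t)
    (ht : ∃ τ ∈ K, A.valuation τ = A.valuation t) {a b : A} (ha : A.IsResidueTranscendental K a)
    (hb : A.IsResidueTranscendental K b) :
    ∃ i j : FractionRing K[X] →+* F, Sim A.valuation t i j ∧
      (∀ c, i (algebraMap K[X] _ (C c)) = c) ∧ (∀ c, j (algebraMap K[X] _ (C c)) = c) ∧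
      i (algebraMap K[X] _ X) = a ∧ j (algebraMap K[X] _ X) = b := by
  have hab : ∀ p : K[X], A.valuation (eval₂RingHom K.subtype (a : F) p) =
      A.valuation (eval₂RingHom K.subtype (b : F) p) := fun p => by
    rcases eq_or_ne p 0 with rfl | hp
    · simp
    · obtain ⟨c, -, hc⟩ := A.exists_valuation_eval_eq K hp
      exact (hc a ha).trans (hc b hb).symm
  obtain ⟨τ, hτ, hτt⟩ := ht
  obtain ⟨i, j, hi, hj, hij⟩ := Sim.of_isDomain (v := A.valuation) (t := t)
    (f := eval₂RingHom K.subtype (a : F)) (g := eval₂RingHom K.subtype (b : F))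
    ((injective_iff_map_eq_zero _).2 fun p hp0 => by
      by_contra hp
      obtain ⟨c, hc0, hc⟩ := A.exists_valuation_eval_eq K hp
      have := hc a ha
      rw [← coe_eval₂RingHom, hp0, map_zero] at this
      exact hc0 ((map_eq_zero _).1 this.symm))
    (fun p q => by rw [hab, hab])
    (fun n hn p => by rw [h.isPow_iff hn, h.isPow_iff hn, hab])
    ⟨C ⟨τ, hτ⟩, by simpa using hτt, by simpa using hτt⟩
  exact ⟨i, j, hij, fun c => by simp [hi], fun c => by simp [hj], by simp [hi], by simp [hj]⟩

end Gauss

namespace IsValuedStructure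

open FirstOrder.Language

variable {M Γ : Type*} [Field M] [LinearOrderedCommGroupWithZero Γ]

theorem congr [LVR.Structure M] {Γ' : Type*} [LinearOrderedCommGroupWithZero Γ']
    {v : Valuation M Γ} {v' : Valuation M Γ'} {t : M} (h : IsValuedStructure v t)
    (hv : v.IsEquiv v') : IsValuedStructure v' t :=
  ⟨h.zero, h.one, h.add, h.mul, fun x => (h.dvd x).trans (hv _ _),
    fun x => (h.N x).trans hv.eq_iff, h.pow⟩

theorem of_valuedStructure (v : Valuation M Γ) {γ : Γ} {t : M} (ht : v t = γ) :
    letI : LVR.Structure M := valuedStructure v γ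
    IsValuedStructure v t := by
  let _ : LVR.Structure M := valuedStructure v γ
  exact ⟨fun _ => rfl, fun _ => rfl, fun _ => rfl, fun _ => rfl, fun _ => Iff.rfl,
    fun _ => by rw [ht]; exact Iff.rfl, fun _ _ => Iff.rfl⟩

theorem snoc_zero_eq {N : Type*} (d : Fin 0 → N) (y : N) :
    (Fin.snoc d y : Fin (0 + 1) → N) = fun _ => y := by
  funext k
  obtain rfl : k = Fin.last 0 := Subsingleton.elim (α := Fin 1) _ _
  exact Fin.snoc_last _ _

theorem _root_.FirstOrder.Language.Substructure.IsElementary.exists_realize {L : Language}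
    {M : Type*} [L.Structure M] {S : L.Substructure M} (hS : S.IsElementary) {α : Type*}
    (φ : L.BoundedFormula α 1) (x : α → M) (hx : ∀ a, x a ∈ S)
    (h : ∃ y, φ.Realize x fun _ => y) : ∃ y ∈ S, φ.Realize x fun _ => y := by
  let E : L.ElementarySubstructure M := ⟨S, hS⟩
  have hE := fun (y : Fin 1 → E) => E.subtype.map_boundedFormula φ (fun a => ⟨x a, hx a⟩) y
  have hE' := E.subtype.map_boundedFormula φ.ex (fun a => ⟨x a, hx a⟩) default
  rw [BoundedFormula.realize_ex, BoundedFormula.realize_ex] at hE'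
  simp only [snoc_zero_eq] at hE'
  obtain ⟨z, hz⟩ := hE'.1 h
  exact ⟨z, z.2, (hE _).2 hz⟩

variable [LVR.Structure M] {v : Valuation M Γ} {t : M} {S : LVR.Substructure M}

/-- The subfield carried by an elementary substructure. -/
theorem exists_subfield (h : IsValuedStructure v t) (hS : S.IsElementary) :
    ∃ K : Subfield M, (∀ x, x ∈ K ↔ x ∈ S) ∧ ∃ τ ∈ K, v τ = v t := by
  have hzero : (0 : M) ∈ S := by
    have := S.fun_mem LVR.zeroSymb default (fun k => k.elim0)
    rwa [h.zero] at this
  have hone : (1 : M) ∈ S := by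
    have := S.fun_mem LVR.oneSymb default (fun k => k.elim0)
    rwa [h.one] at this
  have hadd : ∀ {x y : M}, x ∈ S → y ∈ S → x + y ∈ S := fun {x y} hx hy => by
    have := S.fun_mem LVR.addSymb ![x, y] (by simp [Fin.forall_fin_two, hx, hy])
    rwa [h.add] at this
  have hmul : ∀ {x y : M}, x ∈ S → y ∈ S → x * y ∈ S := fun {x y} hx hy => by
    have := S.fun_mem LVR.mulSymb ![x, y] (by simp [Fin.forall_fin_two, hx, hy])
    rwa [h.mul] at this
  have hneg : ∀ {x : M}, x ∈ S → -x ∈ S := fun {x} hx => by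
    obtain ⟨y, hy, hxy⟩ := hS.exists_realize
      (((LVR.addSymb.apply₂ (Term.var (Sum.inr 0)) (Term.var (Sum.inl 0))).bdEqual
        (Term.var (Sum.inl 1))) : LVR.BoundedFormula (Fin 2) 1) ![x, 0]
      (by simp [Fin.forall_fin_two, hx, hzero])
      ⟨-x, by simp [Functions.apply₂, Term.realize, h.add]⟩
    simp [Functions.apply₂, Term.realize, h.add] at hxy
    rwa [← eq_neg_of_add_eq_zero_left hxy]
  have hinv : ∀ x ∈ S, x⁻¹ ∈ S := fun x hx => by
    rcases eq_or_ne x 0 with rfl | hx0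
    · rwa [inv_zero]
    obtain ⟨y, hy, hxy⟩ := hS.exists_realize
      (((LVR.mulSymb.apply₂ (Term.var (Sum.inr 0)) (Term.var (Sum.inl 0))).bdEqual
        (Term.var (Sum.inl 1))) : LVR.BoundedFormula (Fin 2) 1) ![x, 1]
      (by simp [Fin.forall_fin_two, hx, hone])
      ⟨x⁻¹, by simp [Functions.apply₂, Term.realize, h.mul, hx0]⟩
    simp [Functions.apply₂, Term.realize, h.mul] at hxy
    rwa [← eq_inv_of_mul_eq_one_left hxy]
  obtain ⟨τ, hτ, hτt⟩ := hS.exists_realize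
    (LVR.unifSymb.boundedFormula₁ (Term.var (Sum.inr 0)) : LVR.BoundedFormula Empty 1) default
    (fun k => k.elim) ⟨t, BoundedFormula.realize_rel₁.2 ((h.N _).2 rfl)⟩
  let K : Subfield M :=
    { carrier := S
      mul_mem' := hmul
      one_mem' := hone
      add_mem' := hadd
      zero_mem' := hzero
      neg_mem' := hneg
      inv_mem' := hinv }
  exact ⟨K, fun _ => Iff.rfl, τ, hτ, (h.N _).1 (BoundedFormula.realize_rel₁.1 hτt)⟩

end IsValuedStructure

/-- Let `L` be a valued field whose value group has a least
positive element, regarded as an `L_VR`-structure, elementarily equivalent to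
`ℂ((t))`, and let `K` be an elementary `L_VR`-substructure of `L` (so `L` is an
elementary extension of `K`), with `k ⊆ k_L` the residue field of `K` (the
image of `O_L ∩ K` under the residue map).  If `a, b ∈ O_L` are such that
`res a` and `res b` are transcendental over `k` (no nonzero polynomial with
coefficients in `k` vanishes on them), then `a` and `b` realize the same
complete type over `K`: every `L_VR`-formula with parameters from `K` holds of
`a` iff it holds of `b`. -/
theorem stmt_16 {L : Type*} [Field L] {Γ₀ : Type*} [LinearOrderedCommGroupWithZero Γ₀]
    (v : Valuation L Γ₀) (hsurj : Function.Surjective v)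
    (γ₁ : Γ₀) (hγ₁ : IsLeastPos γ₁) :
    letI : LVR.Structure L := valuedStructure v γ₁
    letI : LVR.Structure (LaurentSeries ℂ) := laurentStructure
    ∀ (_ : L ≅[LVR] LaurentSeries ℂ)
      (S : LVR.Substructure L) (_ : S.IsElementary)
      (a b : v.valuationSubring)
      (_ : ∀ p : Polynomial (IsLocalRing.ResidueField v.valuationSubring), p ≠ 0 →
        (∀ i, p.coeff i ∈ {u | ∃ c : v.valuationSubring, (c : L) ∈ S ∧
            IsLocalRing.residue v.valuationSubring c = u}) →
        Polynomial.eval (IsLocalRing.residue v.valuationSubring a) p ≠ 0)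
      (_ : ∀ p : Polynomial (IsLocalRing.ResidueField v.valuationSubring), p ≠ 0 →
        (∀ i, p.coeff i ∈ {u | ∃ c : v.valuationSubring, (c : L) ∈ S ∧
            IsLocalRing.residue v.valuationSubring c = u}) →
        Polynomial.eval (IsLocalRing.residue v.valuationSubring b) p ≠ 0)
      (φ : LVR.Formula (ℕ ⊕ Fin 1)) (par : ℕ → L) (_ : ∀ i, par i ∈ S),
      φ.Realize (Sum.elim par fun _ => (a : L)) ↔
        φ.Realize (Sum.elim par fun _ => (b : L)) := by
  intro hL S hS a b ha hb φ par hpar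
  let _ : LVR.Structure L := valuedStructure v γ₁
  let _ : LVR.Structure (LaurentSeries ℂ) := laurentStructure
  obtain ⟨t, ht⟩ := hsurj γ₁
  have hv := (IsValuedStructure.of_valuedStructure v ht).congr
    v.isEquiv_valuation_valuationSubring
  have hM : TModel v.valuationSubring.valuation t :=
    TModel.of_elementarilyEquivalent hv
      (IsValuedStructure.of_valuedStructure Valued.v (LaurentSeries.v_single 1)) hL
      LaurentSeries.tModel
  obtain ⟨K, hK, hτ⟩ := hv.exists_subfield hS
  obtain ⟨i, j, hij, hi, hj, hiX, hjX⟩ :=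
    v.valuationSubring.exists_sim_of_isResidueTranscendental K hM hτ (a := a) (b := b)
      (fun p hp h => ha p hp fun n => (h n).imp fun c hc => ⟨(hK _).1 hc.1, hc.2⟩)
      (fun p hp h => hb p hp fun n => (h n).imp fun c hc => ⟨(hK _).1 hc.1, hc.2⟩)
  let x : ℕ ⊕ Fin 1 → FractionRing K[X] := Sum.elim
    (fun n => algebraMap K[X] _ (C ⟨par n, (hK _).2 (hpar n)⟩)) fun _ => algebraMap K[X] _ X
  have hxi : (Sum.elim par fun _ => (a : L)) = fun n => i (x n) := by
    funext n
    rcases n with n | n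
    · exact (hi ⟨par n, _⟩).symm
    · exact hiX.symm
  have hxj : (Sum.elim par fun _ => (b : L)) = fun n => j (x n) := by
    funext n
    rcases n with n | n
    · exact (hj ⟨par n, _⟩).symm
    · exact hjX.symm
  have hdef : ∀ f : FractionRing K[X] → L,
      (default : Fin 0 → L) = fun k => f ((default : Fin 0 → FractionRing K[X]) k) :=
    fun f => Subsingleton.elim _ _
  rw [hxi, hxj]
  constructor
  · intro h
    rw [Language.Formula.Realize, hdef i] at h
    rw [Language.Formula.Realize, hdef j]
    exact IsValuedStructure.realize_of_sim φ hv hM hij x _ h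
  · intro h
    rw [Language.Formula.Realize, hdef j] at h
    rw [Language.Formula.Realize, hdef i]
    exact IsValuedStructure.realize_of_sim φ hv hM hij.symm x _ h
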